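/- Let r ≥ 3 and let F be a quasi-linear, head-tail-mixing r-graph which admits the descriptive sequence XX…XZZYY…Y (consisting of r−2 letters X, then two letters Z, then r−2 letters Y). Then the uniform Turán density of F equals 1/4: there exists a locally 1/4-dense sequence of F-free r-graphs, and for every ε > 0 every locally (1/4+ε)-dense sequence of r-graphs has a member containing F as a subgraph. -/

import Mathlib

namespace UTD

/-- An `r`-uniform hypergraph on a finite vertex set of naturals. -/
structure RGraph (r : ℕ) where
  verts : Finset ℕ
  edges : Finset (Finset ℕ)
  edges_subset : ∀ e ∈ edges, e ⊆ verts
  edges_card : ∀ e ∈ edges, e.card = r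

/-- `F` is a subgraph of `H`: an injection of `V(F)` into `V(H)` mapping edges to edges. -/
def IsSubgraph {r : ℕ} (F H : RGraph r) : Prop :=
  ∃ φ : ℕ → ℕ, Set.InjOn φ ↑F.verts ∧ (∀ v ∈ F.verts, φ v ∈ H.verts) ∧
    ∀ e ∈ F.edges, e.image φ ∈ H.edges

/-- `H` is `(d, ε)`-dense: every `S ⊆ V(H)` with `|S| ≥ ε|V(H)|` spans at least
`(d - ε) * C(|S|, r)` edges. -/
def IsDense {r : ℕ} (H : RGraph r) (d ε : ℝ) : Prop :=
  ∀ S ⊆ H.verts, ε * H.verts.card ≤ S.card →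
    (d - ε) * (S.card.choose r : ℝ) ≤ ((H.edges.filter (fun e => e ⊆ S)).card : ℝ)

/-- A sequence of `r`-graphs is locally `d`-dense. -/
def LocallyDense {r : ℕ} (H : ℕ → RGraph r) (d : ℝ) : Prop :=
  ∃ ε : ℕ → ℝ, (∀ n, 0 < ε n) ∧
    Filter.Tendsto ε Filter.atTop (nhds 0) ∧
    Filter.Tendsto (fun n => (H n).verts.card) Filter.atTop Filter.atTop ∧
    ∀ n, IsDense (H n) d (ε n)

/-- The role (set of ranks, 1-indexed) that the elements of `p` play within the
set `e`, with respect to the order given by `ord`. -/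
def role (ord : ℕ → ℕ) (e p : Finset ℕ) : Finset ℕ :=
  p.image (fun v => (e.filter (fun w => ord w < ord v)).card + 1)

/-- Twin pair of edges: distinct edges intersecting in exactly two vertices. -/
def IsTwin {r : ℕ} (F : RGraph r) (e f : Finset ℕ) : Prop :=
  e ∈ F.edges ∧ f ∈ F.edges ∧ e ≠ f ∧ (e ∩ f).card = 2

/-- Quasi-linear: every edge `e` has a unique twin, and all other edges meet `e`
in at most one vertex. -/
def QuasiLinear {r : ℕ} (F : RGraph r) : Prop :=
  ∀ e ∈ F.edges, ∃ f ∈ F.edges, f ≠ e ∧ (e ∩ f).card = 2 ∧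
    ∀ f' ∈ F.edges, f' ≠ e → f' ≠ f → (e ∩ f').card ≤ 1

/-- `F` with the vertex order `ord` is consistently ordered. -/
def ConsistentlyOrdered {r : ℕ} (F : RGraph r) (ord : ℕ → ℕ) : Prop :=
  ∀ e f, IsTwin F e f → role ord e (e ∩ f) = role ord f (e ∩ f)

/-- `F` is consistent: some linear order of its vertices makes it consistently ordered. -/
def Consistent {r : ℕ} (F : RGraph r) : Prop :=
  ∃ ord : ℕ → ℕ, Set.InjOn ord ↑F.verts ∧ ConsistentlyOrdered F ord

/-- `p` is the head of the edge `e`: its two smallest vertices w.r.t. `ord`. -/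
def IsHead (ord : ℕ → ℕ) (e p : Finset ℕ) : Prop :=
  p ⊆ e ∧ p.card = 2 ∧ ∀ u ∈ p, ∀ w ∈ e, w ∉ p → ord u < ord w

/-- `p` is the tail of the edge `e`: its two largest vertices w.r.t. `ord`. -/
def IsTail (ord : ℕ → ℕ) (e p : Finset ℕ) : Prop :=
  p ⊆ e ∧ p.card = 2 ∧ ∀ u ∈ p, ∀ w ∈ e, w ∉ p → ord w < ord u

/-- Head-tail-mixing: for every linear order of the vertex set there are edges
`e, f` such that the head of `e` equals the tail of `f`. -/
def HeadTailMixing {r : ℕ} (F : RGraph r) : Prop :=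
  ∀ ord : ℕ → ℕ, Set.InjOn ord ↑F.verts →
    ∃ e ∈ F.edges, ∃ f ∈ F.edges, ∃ p : Finset ℕ, IsHead ord e p ∧ IsTail ord f p

inductive Letter : Type
  | X | Y | Z
  deriving DecidableEq

/-- A descriptive sequence of order `r`: `2r - 2` letters, among which `r - 2`
are `X`, `r - 2` are `Y`, and two are `Z`. -/
def IsDescSeq (r : ℕ) (σ : Fin (2 * r - 2) → Letter) : Prop :=
  (Finset.univ.filter (fun i => σ i = Letter.X)).card = r - 2 ∧
  (Finset.univ.filter (fun i => σ i = Letter.Y)).card = r - 2 ∧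
  (Finset.univ.filter (fun i => σ i = Letter.Z)).card = 2

/-- The descriptive sequence `XX…XZZYY…Y`. -/
def headTailSeq (r : ℕ) : Fin (2 * r - 2) → Letter := fun i =>
  if (i : ℕ) < r - 2 then Letter.X
  else if (i : ℕ) < r then Letter.Z
  else Letter.Y

/-- The role (set of ranks, 1-indexed) played by the positions of the two `Z`s
within the positions carrying letters different from `avoid`. -/
def seqRole (r : ℕ) (σ : Fin (2 * r - 2) → Letter) (avoid : Letter) : Finset ℕ :=
  (Finset.univ.filter (fun i => σ i = Letter.Z)).image
    (fun i => (Finset.univ.filter (fun j => σ j ≠ avoid ∧ j < i)).card + 1)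

/-- A descriptive sequence is consistent if its two `Z`s play the same role among
the `X/Z` positions as among the `Y/Z` positions. -/
def SeqConsistent (r : ℕ) (σ : Fin (2 * r - 2) → Letter) : Prop :=
  seqRole r σ Letter.Y = seqRole r σ Letter.X

def SeqInconsistent (r : ℕ) (σ : Fin (2 * r - 2) → Letter) : Prop :=
  IsDescSeq r σ ∧ ¬ SeqConsistent r σ

/-- The descriptive sequence `σ` describes the pair of edges `{e, f}` under the
vertex order `ord`. -/
def Describes (r : ℕ) (σ : Fin (2 * r - 2) → Letter) (ord : ℕ → ℕ)
    (e f : Finset ℕ) : Prop :=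
  ∃ w : Fin (2 * r - 2) → ℕ,
    (∀ i j : Fin (2 * r - 2), i < j → ord (w i) < ord (w j)) ∧
    (∀ v : ℕ, v ∈ e ∪ f ↔ ∃ i, w i = v) ∧
    (((∀ i, w i ∈ e ↔ σ i ≠ Letter.Y) ∧ (∀ i, w i ∈ f ↔ σ i ≠ Letter.X)) ∨
     ((∀ i, w i ∈ e ↔ σ i ≠ Letter.X) ∧ (∀ i, w i ∈ f ↔ σ i ≠ Letter.Y)))

/-- A quasi-linear `r`-graph admits the descriptive sequence `σ`: there is a
linear order of its vertices in which every twin pair of edges is described by `σ`. -/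
def AdmitsSeq {r : ℕ} (F : RGraph r) (σ : Fin (2 * r - 2) → Letter) : Prop :=
  ∃ ord : ℕ → ℕ, Set.InjOn ord ↑F.verts ∧
    ∀ e f, IsTwin F e f → Describes r σ ord e f

/-- Linear hypergraph: any two distinct edges intersect in at most one vertex. -/
def LinearGraph {r : ℕ} (H : RGraph r) : Prop :=
  ∀ e ∈ H.edges, ∀ f ∈ H.edges, e ≠ f → (e ∩ f).card ≤ 1

/-- Nowhere-empty sequence of `r`-graphs. -/
def NowhereEmpty {r : ℕ} (H : ℕ → RGraph r) : Prop :=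
  ∀ c : ℝ, 0 < c → ∃ n₀ : ℕ, ∀ n ≥ n₀, ∀ S : Fin r → Finset ℕ,
    (∀ i, S i ⊆ (H n).verts) →
    (∀ i j, i ≠ j → Disjoint (S i) (S j)) →
    (∀ i, c * (H n).verts.card ≤ (S i).card) →
    ∃ e ∈ (H n).edges, ∀ i, (e ∩ S i).Nonempty

/-- A `(k, r)`-reduced hypergraph. -/
structure ReducedGraph (k r : ℕ) where
  part : Fin k → Fin k → Finset ℕ
  part_symm : ∀ i j, part i j = part j i
  part_disj : ∀ i j i' j' : Fin k, i < j → i' < j' → (i, j) ≠ (i', j') →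
    Disjoint (part i j) (part i' j')
  edges : Finset (Finset ℕ)
  edges_card : ∀ e ∈ edges, e.card = r.choose 2
  edges_struct : ∀ e ∈ edges, ∃ t : Fin r → Fin k, StrictMono t ∧
    ∀ a b : Fin r, a < b → (e ∩ part (t a) (t b)).card = 1

/-- The constituent `A_{t 0, …, t (r-1)}` of a reduced hypergraph. -/
def constituent {k r : ℕ} (H : ReducedGraph k r) (t : Fin r → Fin k) :
    Finset (Finset ℕ) :=
  H.edges.filter (fun e => ∀ a b : Fin r, a < b → (e ∩ H.part (t a) (t b)).card = 1)

/-- A reduced hypergraph has density at least `d`. -/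
def HasDensity {k r : ℕ} (H : ReducedGraph k r) (d : ℝ) : Prop :=
  ∀ t : Fin r → Fin k, StrictMono t →
    d * ∏ p ∈ Finset.univ.filter (fun p : Fin r × Fin r => p.1 < p.2),
      ((H.part (t p.1) (t p.2)).card : ℝ) ≤ ((constituent H t).card : ℝ)

/-- The `(2r-2)`-tuple of indices `t` admits the descriptive sequence `σ` in the
reduced hypergraph `H`. -/
def TupleAdmits {k r : ℕ} (H : ReducedGraph k r) (σ : Fin (2 * r - 2) → Letter)
    (t : Fin (2 * r - 2) → Fin k) : Prop :=
  ∃ tx ty : Fin r → Fin k, StrictMono tx ∧ StrictMono ty ∧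
    Set.range tx = t '' {i | σ i ≠ Letter.Y} ∧
    Set.range ty = t '' {i | σ i ≠ Letter.X} ∧
    ∃ eX ∈ constituent H tx, ∃ eY ∈ constituent H ty, (eX ∩ eY).card = 1

/-- The uniform Turán density threshold `C(r,2)^(-C(r,2))`. -/
noncomputable def piR (r : ℕ) : ℝ := ((r.choose 2 : ℝ) ^ (r.choose 2))⁻¹


end UTD

set_option linter.all false

namespace UTD
open Finset

/-! ### Product expectations -/
section Expectation
variable {ι α : Type*} [Fintype ι] [DecidableEq ι] [Fintype α]

/-- expectation of `F` under the product of the weights `w i`. -/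
def Ex (w : ι → α → ℝ) (F : (ι → α) → ℝ) : ℝ := ∑ x, (∏ i, w i (x i)) * F x

/-- all weights are probability weights. -/
def IsP (w : ι → α → ℝ) : Prop := ∀ i, (∀ a, 0 ≤ w i a) ∧ ∑ a, w i a = 1

/-- `F` depends only on the coordinates in `D`. -/
def Dep {β : Type*} (F : (ι → α) → β) (D : Finset ι) : Prop :=
  ∀ x y, (∀ i ∈ D, x i = y i) → F x = F y

theorem Dep.mono {β : Type*} {F : (ι → α) → β} {D D' : Finset ι} (h : Dep F D) (hD : D ⊆ D') :
    Dep F D' := fun x y hxy => h x y (fun i hi => hxy i (hD hi))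

theorem Dep.mul {F G : (ι → α) → ℝ} {D : Finset ι} (h : Dep F D) (h' : Dep G D) :
    Dep (fun x => F x * G x) D := fun x y hxy => by
  show F x * G x = F y * G y
  rw [h x y hxy, h' x y hxy]

theorem Ex_add (w : ι → α → ℝ) (F G : (ι → α) → ℝ) :
    Ex w (fun x => F x + G x) = Ex w F + Ex w G := by
  simp [Ex, mul_add, sum_add_distrib]

theorem Ex_sub (w : ι → α → ℝ) (F G : (ι → α) → ℝ) :
    Ex w (fun x => F x - G x) = Ex w F - Ex w G := by
  simp [Ex, mul_sub, sum_sub_distrib]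

theorem Ex_mul_left (w : ι → α → ℝ) (c : ℝ) (F : (ι → α) → ℝ) :
    Ex w (fun x => c * F x) = c * Ex w F := by
  simp only [Ex, mul_sum]
  exact sum_congr rfl fun x _ => by ring

theorem Ex_mul_right (w : ι → α → ℝ) (c : ℝ) (F : (ι → α) → ℝ) :
    Ex w (fun x => F x * c) = Ex w F * c := by
  simp only [Ex, sum_mul]
  exact sum_congr rfl fun x _ => by ring

theorem Ex_sum {κ : Type*} (s : Finset κ) (w : ι → α → ℝ) (F : κ → (ι → α) → ℝ) :
    Ex w (fun x => ∑ k ∈ s, F k x) = ∑ k ∈ s, Ex w (F k) := by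
  simp only [Ex, mul_sum]
  exact sum_comm

theorem IsP.prod_nonneg {w : ι → α → ℝ} (hw : IsP w) (x : ι → α) : 0 ≤ ∏ i, w i (x i) :=
  Finset.prod_nonneg fun i _ => (hw i).1 _

theorem IsP.sum_prod {w : ι → α → ℝ} (hw : IsP w) : ∑ x : ι → α, ∏ i, w i (x i) = 1 := by
  rw [← Fintype.prod_sum]
  exact Finset.prod_eq_one fun i _ => (hw i).2

theorem Ex_const {w : ι → α → ℝ} (hw : IsP w) (c : ℝ) : Ex w (fun _ => c) = c := by
  simp only [Ex, ← sum_mul, hw.sum_prod, one_mul]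

theorem Ex_mono {w : ι → α → ℝ} (hw : IsP w) {F G : (ι → α) → ℝ} (h : ∀ x, F x ≤ G x) :
    Ex w F ≤ Ex w G :=
  sum_le_sum fun x _ => mul_le_mul_of_nonneg_left (h x) (hw.prod_nonneg x)

theorem Ex_nonneg {w : ι → α → ℝ} (hw : IsP w) {F : (ι → α) → ℝ} (h : ∀ x, 0 ≤ F x) :
    0 ≤ Ex w F :=
  sum_nonneg fun x _ => mul_nonneg (hw.prod_nonneg x) (h x)

theorem Ex_le {w : ι → α → ℝ} (hw : IsP w) {F : (ι → α) → ℝ} {c : ℝ} (h : ∀ x, F x ≤ c) :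
    Ex w F ≤ c := by
  have := Ex_mono hw h
  rwa [Ex_const hw] at this

theorem le_Ex {w : ι → α → ℝ} (hw : IsP w) {F : (ι → α) → ℝ} {c : ℝ} (h : ∀ x, c ≤ F x) :
    c ≤ Ex w F := by
  have := Ex_mono hw h
  rwa [Ex_const hw] at this

theorem abs_Ex_le {w : ι → α → ℝ} (hw : IsP w) (F : (ι → α) → ℝ) :
    |Ex w F| ≤ Ex w (fun x => |F x|) := by
  unfold Ex
  refine (abs_sum_le_sum_abs _ _).trans (le_of_eq (sum_congr rfl fun x _ => ?_))
  rw [abs_mul, abs_of_nonneg (hw.prod_nonneg x)]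

theorem Ex_sq_le {w : ι → α → ℝ} (hw : IsP w) (F : (ι → α) → ℝ) :
    (Ex w F) ^ 2 ≤ Ex w (fun x => F x ^ 2) := by
  have h : 0 ≤ Ex w (fun x => (F x - Ex w F) ^ 2) := Ex_nonneg hw fun x => sq_nonneg _
  have h2 : Ex w (fun x => (F x - Ex w F) ^ 2)
      = Ex w (fun x => F x ^ 2) - Ex w F ^ 2 := by
    have : (fun x => (F x - Ex w F) ^ 2)
        = fun x => (F x ^ 2 - (2 * Ex w F) * F x) + (Ex w F) ^ 2 := by
      funext x; ring
    rw [this, Ex_add, Ex_sub, Ex_mul_left, Ex_const hw]; ring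
  linarith

/-- swapping coordinates outside `A` between two independent samples. -/
theorem sum_swap (A : Finset ι) (P : (ι → α) → (ι → α) → ℝ) :
    ∑ x, ∑ y, P x y = ∑ x, ∑ y, P (A.piecewise x y) (A.piecewise y x) := by
  rw [← Fintype.sum_prod_type', ← Fintype.sum_prod_type']
  symm
  refine Fintype.sum_equiv
    (Function.Involutive.toPerm
      (fun p : (ι → α) × (ι → α) => (A.piecewise p.1 p.2, A.piecewise p.2 p.1)) ?_) _ _ ?_
  · rintro ⟨x, y⟩
    ext i <;> by_cases h : i ∈ A <;> simp [h]
  · rintro ⟨x, y⟩; rfl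

theorem Ex_eq_double {w w' : ι → α → ℝ} (hw' : IsP w') (F : (ι → α) → ℝ) :
    Ex w F = ∑ x : ι → α, ∑ y : ι → α, (∏ i, w i (x i) * w' i (y i)) * F x := by
  unfold Ex
  refine sum_congr rfl fun x _ => ?_
  rw [← sum_mul]
  congr 1
  simp_rw [prod_mul_distrib]
  rw [← mul_sum, hw'.sum_prod, mul_one]

/-- resampling. -/
theorem Ex_resample {w : ι → α → ℝ} (hw : IsP w) (A : Finset ι) (F : (ι → α) → ℝ) :
    Ex w (fun x => Ex w (fun y => F (A.piecewise x y))) = Ex w F := by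
  rw [Ex_eq_double hw F, sum_swap A]
  unfold Ex
  refine sum_congr rfl fun x _ => ?_
  rw [mul_sum]
  refine sum_congr rfl fun y _ => ?_
  rw [← mul_assoc, ← prod_mul_distrib]
  congr 1
  refine prod_congr rfl fun i _ => ?_
  by_cases h : i ∈ A <;> simp [h, mul_comm]

theorem Ex_congr_dep {w w' : ι → α → ℝ} (hw : IsP w) (hw' : IsP w') {F : (ι → α) → ℝ}
    {D : Finset ι} (hF : Dep F D) (h : ∀ i ∈ D, w i = w' i) : Ex w F = Ex w' F := by
  rw [Ex_eq_double hw' F, Ex_eq_double hw F, sum_swap D]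
  refine sum_congr rfl fun x _ => sum_congr rfl fun y _ => ?_
  congr 1
  · refine prod_congr rfl fun i _ => ?_
    by_cases hi : i ∈ D
    · simp [hi, h i hi]
    · simp [hi, mul_comm]
  · exact hF _ _ fun i hi => by simp [hi]

theorem Ex_mul_indep {w : ι → α → ℝ} (hw : IsP w) {F G : (ι → α) → ℝ}
    {D D' : Finset ι} (hF : Dep F D) (hG : Dep G D') (hD : Disjoint D D') :
    Ex w (fun x => F x * G x) = Ex w F * Ex w G := by
  rw [← Ex_resample hw D, ← Ex_mul_right]
  congr 1
  funext x
  rw [← Ex_mul_left]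
  congr 1
  funext y
  congr 1
  · exact hF _ _ fun i hi => by simp [hi]
  · refine hG _ _ fun i hi => ?_
    have : i ∉ D := fun h => (disjoint_left.mp hD h hi)
    simp [this]

theorem Ex_coord {w : ι → α → ℝ} (hw : IsP w) (i : ι) (u : α → ℝ) :
    Ex w (fun x => u (x i)) = ∑ a, w i a * u a := by
  classical
  have h1 : Ex w (fun x => u (x i)) = ∑ x : ι → α, ∏ j, (w j (x j) * if j = i then u (x j) else 1) := by
    unfold Ex
    refine sum_congr rfl fun x _ => ?_
    rw [prod_mul_distrib]
    congr 1
    simp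
  rw [h1, ← Fintype.prod_sum (fun j a => w j a * if j = i then u a else 1)]
  rw [← mul_prod_erase univ _ (mem_univ i)]
  rw [prod_eq_one, mul_one]
  · simp
  · intro j hj
    have : j ≠ i := ne_of_mem_erase hj
    simp [this, (hw j).2]

theorem Ex_prod_coord {w : ι → α → ℝ} (hw : IsP w) (B : Finset ι) (u : ι → α → ℝ) :
    Ex w (fun x => ∏ i ∈ B, u i (x i)) = ∏ i ∈ B, Ex w (fun x => u i (x i)) := by
  induction B using Finset.induction_on with
  | empty => simp [Ex_const hw]
  | insert i B hi ih =>
    simp only [prod_insert hi]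
    rw [← ih]
    refine Ex_mul_indep hw (D := {i}) (D' := B) ?_ ?_ (by simpa using hi)
    · intro x y h; simp [h i (by simp)]
    · intro x y h; exact prod_congr rfl fun j hj => by rw [h j hj]

theorem Ex_update_linear (w : ι → α → ℝ) (i : ι) (p q : α → ℝ) (s t : ℝ) (F : (ι → α) → ℝ) :
    Ex (Function.update w i (fun a => s * p a + t * q a)) F
      = s * Ex (Function.update w i p) F + t * Ex (Function.update w i q) F := by
  have key : ∀ (r : α → ℝ) (x : ι → α), ∏ j, Function.update w i r j (x j)
      = r (x i) * ∏ j ∈ univ.erase i, w j (x j) := by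
    intro r x
    rw [← mul_prod_erase univ _ (mem_univ i)]
    congr 1
    · simp
    · refine prod_congr rfl fun j hj => ?_
      rw [Function.update_of_ne (ne_of_mem_erase hj)]
  unfold Ex
  rw [mul_sum, mul_sum, ← sum_add_distrib]
  refine sum_congr rfl fun x _ => ?_
  rw [key, key, key]; ring

theorem IsP.update {w : ι → α → ℝ} (hw : IsP w) (i : ι) {p : α → ℝ} (hp : ∀ a, 0 ≤ p a)
    (hp1 : ∑ a, p a = 1) : IsP (Function.update w i p) := by
  intro j
  by_cases h : j = i
  · subst h; simpa using ⟨hp, hp1⟩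
  · rw [Function.update_of_ne h]; exact hw j

end Expectation
end UTD

namespace UTD
open Finset

/-! ### Energies and regularity -/
section Energy
variable {ι α : Type*} [Fintype ι] [DecidableEq ι] [Fintype α]

/-- conditional average of `f` given the coordinates in `A`. -/
def cav (w : ι → α → ℝ) (f : (ι → α) → ℝ) (A : Finset ι) (x : ι → α) : ℝ :=
  Ex w (fun y => f (A.piecewise x y))

theorem cav_dep (w : ι → α → ℝ) (f : (ι → α) → ℝ) (A : Finset ι) : Dep (cav w f A) A := by
  intro x y h
  unfold cav
  congr 1
  funext z
  congr 1
  funext i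
  by_cases hi : i ∈ A
  · simp [hi, h i hi]
  · simp [hi]

theorem cav_nonneg {w : ι → α → ℝ} (hw : IsP w) {f : (ι → α) → ℝ} (hf : ∀ x, 0 ≤ f x)
    (A : Finset ι) (x : ι → α) : 0 ≤ cav w f A x := Ex_nonneg hw fun y => hf _

theorem cav_le_one {w : ι → α → ℝ} (hw : IsP w) {f : (ι → α) → ℝ} (hf : ∀ x, f x ≤ 1)
    (A : Finset ι) (x : ι → α) : cav w f A x ≤ 1 := Ex_le hw fun y => hf _

theorem piecewise_dep (f : (ι → α) → ℝ) (A : Finset ι) (x : ι → α) :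
    Dep (fun y => f (A.piecewise x y)) (univ \ A) := by
  intro y z h
  show f _ = f _
  congr 1
  funext i
  by_cases hi : i ∈ A
  · simp [hi]
  · simp [hi, h i (by simp [hi])]

theorem cav_congr {w w' : ι → α → ℝ} (hw : IsP w) (hw' : IsP w') (f : (ι → α) → ℝ)
    (A : Finset ι) (h : ∀ i ∉ A, w i = w' i) (x : ι → α) : cav w f A x = cav w' f A x :=
  Ex_congr_dep hw hw' (piecewise_dep f A x) fun i hi => h i (by simpa using hi)

/-- energy. -/
def En (w : ι → α → ℝ) (f : (ι → α) → ℝ) (A : Finset ι) : ℝ := Ex w (fun x => (cav w f A x) ^ 2)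

theorem sq_dep {F : (ι → α) → ℝ} {D : Finset ι} (h : Dep F D) : Dep (fun x => F x ^ 2) D :=
  fun x y hxy => by show F x ^ 2 = F y ^ 2; rw [h x y hxy]

theorem En_split {w : ι → α → ℝ} (hw : IsP w) (f : (ι → α) → ℝ) (A : Finset ι) (i : ι)
    {p q : α → ℝ} (hp : ∀ a, 0 ≤ p a) (hp1 : ∑ a, p a = 1) (hq : ∀ a, 0 ≤ q a)
    (hq1 : ∑ a, q a = 1) {s t : ℝ} (hs : 0 ≤ s) (ht : 0 ≤ t) (hst : s + t = 1)
    (hwi : w i = fun a => s * p a + t * q a) :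
    En w f A + (if i ∈ A then 0 else s * t * Ex w (fun x =>
      (cav (Function.update w i p) f A x - cav (Function.update w i q) f A x) ^ 2))
      = s * En (Function.update w i p) f A + t * En (Function.update w i q) f A := by
  have hP := hw.update i hp hp1
  have hQ := hw.update i hq hq1
  have hwu : w = Function.update w i (fun a => s * p a + t * q a) := by
    rw [← hwi, Function.update_eq_self]
  by_cases hi : i ∈ A
  · rw [if_pos hi, add_zero]
    have e1 : ∀ x, cav (Function.update w i p) f A x = cav w f A x := fun x =>
      cav_congr hP hw f A (fun j hj => Function.update_of_ne (fun h : j = i => hj (h ▸ hi)) _ _) x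
    have e2 : ∀ x, cav (Function.update w i q) f A x = cav w f A x := fun x =>
      cav_congr hQ hw f A (fun j hj => Function.update_of_ne (fun h : j = i => hj (h ▸ hi)) _ _) x
    unfold En
    simp_rw [e1, e2]
    rw [← Ex_update_linear, ← hwu]
  · rw [if_neg hi]
    have o1 : En (Function.update w i p) f A
        = Ex w (fun x => (cav (Function.update w i p) f A x) ^ 2) :=
      Ex_congr_dep hP hw (sq_dep (cav_dep _ f A))
        (fun j hj => Function.update_of_ne (fun h : j = i => hi (h ▸ hj)) _ _)
    have o2 : En (Function.update w i q) f A
        = Ex w (fun x => (cav (Function.update w i q) f A x) ^ 2) :=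
      Ex_congr_dep hQ hw (sq_dep (cav_dep _ f A))
        (fun j hj => Function.update_of_ne (fun h : j = i => hi (h ▸ hj)) _ _)
    have o3 : ∀ x, cav w f A x = s * cav (Function.update w i p) f A x
        + t * cav (Function.update w i q) f A x := by
      intro x
      unfold cav
      rw [← Ex_update_linear, ← hwu]
    rw [o1, o2]
    unfold En
    rw [← Ex_mul_left, ← Ex_add, ← Ex_mul_left, ← Ex_mul_left, ← Ex_add]
    congr 1
    funext x
    rw [o3]
    have : t = 1 - s := by linarith
    subst this; ring

variable {κ : Type*} [Fintype κ]

/-- total energy. -/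
def Phi (f : κ → (ι → α) → ℝ) (A : κ → Finset ι) (w : ι → α → ℝ) : ℝ := ∑ k, En w (f k) (A k)

theorem Phi_split {w : ι → α → ℝ} (hw : IsP w) (f : κ → (ι → α) → ℝ) (A : κ → Finset ι) (i : ι)
    {p q : α → ℝ} (hp : ∀ a, 0 ≤ p a) (hp1 : ∑ a, p a = 1) (hq : ∀ a, 0 ≤ q a)
    (hq1 : ∑ a, q a = 1) {s t : ℝ} (hs : 0 ≤ s) (ht : 0 ≤ t) (hst : s + t = 1)
    (hwi : w i = fun a => s * p a + t * q a) (k : κ) (hk : i ∉ A k) :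
    Phi f A w + s * t * Ex w (fun x =>
      (cav (Function.update w i p) (f k) (A k) x - cav (Function.update w i q) (f k) (A k) x) ^ 2)
      ≤ s * Phi f A (Function.update w i p) + t * Phi f A (Function.update w i q) := by
  classical
  unfold Phi
  rw [mul_sum, mul_sum, ← sum_add_distrib,
    ← sum_congr rfl (fun l _ => En_split hw (f l) (A l) i hp hp1 hq hq1 hs ht hst hwi),
    sum_add_distrib]
  gcongr
  have := single_le_sum (s := univ) (f := fun l => if i ∈ A l then 0 else s * t * Ex w (fun x =>
      (cav (Function.update w i p) (f l) (A l) x - cav (Function.update w i q) (f l) (A l) x) ^ 2))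
      (fun l _ => by
        split_ifs
        · exact le_rfl
        · exact mul_nonneg (mul_nonneg hs ht) (Ex_nonneg hw fun x => sq_nonneg _)) (mem_univ k)
  rw [if_neg hk] at this
  exact this

theorem exists_nearmax (Φ : (ι → α → ℝ) → ℝ) {B η C : ℝ} (hη : 0 < η)
    (h0 : ∀ w, IsP w → 0 ≤ Φ w) (hB : ∀ w, IsP w → Φ w ≤ B) (hC : 1 ≤ C) (J : ℕ)
    (hJ : B < J * η) (w0 : ι → α → ℝ) (hw0 : IsP w0) :
    ∃ w, IsP w ∧ (∀ i a, w i a ≤ C ^ J * w0 i a) ∧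
      ∀ w', IsP w' → (∀ i a, w' i a ≤ C * w i a) → Φ w' ≤ Φ w + η := by
  by_contra hcon
  push Not at hcon
  have key : ∀ j : ℕ, j ≤ J → ∃ w, IsP w ∧ (∀ i a, w i a ≤ C ^ j * w0 i a) ∧ j * η ≤ Φ w := by
    intro j
    induction j with
    | zero => intro _; exact ⟨w0, hw0, by simp, by simpa using h0 _ hw0⟩
    | succ j ih =>
      intro hj
      obtain ⟨w, hw, hwC, hwΦ⟩ := ih (by omega)
      obtain ⟨w', hw', hwC', hwΦ'⟩ := hcon w hw (fun i a => (hwC i a).trans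
        (mul_le_mul_of_nonneg_right (pow_le_pow_right₀ hC (by omega)) ((hw0 i).1 a)))
      refine ⟨w', hw', fun i a => ?_, ?_⟩
      · calc w' i a ≤ C * w i a := hwC' i a
          _ ≤ C * (C ^ j * w0 i a) := by
            exact mul_le_mul_of_nonneg_left (hwC i a) (by linarith)
          _ = _ := by ring
      · push_cast; nlinarith
  obtain ⟨w, hw, _, h⟩ := key J le_rfl
  linarith [hB w hw]

theorem reg_induct (f : κ → (ι → α) → ℝ) (A : κ → Finset ι) {w : ι → α → ℝ} (hw : IsP w)
    {η C : ℝ} (hη : 0 < η) (hC : 2 ≤ C)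
    (hmax : ∀ w', IsP w' → (∀ i a, w' i a ≤ C * w i a) → Phi f A w' ≤ Phi f A w + η)
    (k : κ) (p q : ι → α → ℝ) (s : ι → ℝ) (B : Finset ι) (hB : Disjoint B (A k))
    (hp : ∀ i ∈ B, (∀ a, 0 ≤ p i a) ∧ ∑ a, p i a = 1 ∧ ∀ a, p i a ≤ C * w i a)
    (hq : ∀ i ∈ B, (∀ a, 0 ≤ q i a) ∧ ∑ a, q i a = 1 ∧ ∀ a, q i a ≤ C * w i a)
    (hs : ∀ i ∈ B, 1 / C ≤ s i ∧ s i ≤ 1)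
    (hwi : ∀ i ∈ B, w i = fun a => s i * p i a + (1 - s i) * q i a) :
    Phi f A w + η - Phi f A (B.piecewise p w) ≤ C ^ B.card * η ∧
    Ex w (fun x => |cav (B.piecewise p w) (f k) (A k) x - cav w (f k) (A k) x|)
      ≤ B.card * √(C ^ (Fintype.card ι) * η) := by
  induction B using Finset.induction_on with
  | empty =>
    simp [Ex_const hw]
  | insert i B hi ih =>
    obtain ⟨ih1, ih2⟩ := ih (hB.mono_left (subset_insert _ _))
      (fun j hj => hp j (mem_insert_of_mem hj)) (fun j hj => hq j (mem_insert_of_mem hj))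
      (fun j hj => hs j (mem_insert_of_mem hj)) (fun j hj => hwi j (mem_insert_of_mem hj))
    have hiB := mem_insert_self i B
    set v := B.piecewise p w with hv
    have hvP : IsP v := by
      intro j
      by_cases hj : j ∈ B
      · simp only [hv, piecewise_eq_of_mem _ _ _ hj]
        exact ⟨(hp j (mem_insert_of_mem hj)).1, (hp j (mem_insert_of_mem hj)).2.1⟩
      · simp only [hv, piecewise_eq_of_notMem _ _ _ hj]; exact hw j
    have hvC : ∀ j a, v j a ≤ C * w j a := by
      intro j a
      by_cases hj : j ∈ B
      · simp only [hv, piecewise_eq_of_mem _ _ _ hj]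
        exact (hp j (mem_insert_of_mem hj)).2.2 a
      · simp only [hv, piecewise_eq_of_notMem _ _ _ hj]
        nlinarith [(hw j).1 a]
    have hvi : v i = w i := by simp only [hv, piecewise_eq_of_notMem _ _ _ hi]
    have hins : (insert i B).piecewise p w = Function.update v i (p i) := by
      rw [piecewise_insert]
    obtain ⟨hp0, hp1, hpC⟩ := hp i hiB
    obtain ⟨hq0, hq1, hqC⟩ := hq i hiB
    obtain ⟨hs1, hs2⟩ := hs i hiB
    have hCpos : 0 < C := by linarith
    have hspos : 0 < s i := lt_of_lt_of_le (by positivity) hs1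
    have hAk : i ∉ A k := disjoint_left.mp hB hiB
    have hsplit := Phi_split hvP f A i hp0 hp1 hq0 hq1 hspos.le (by linarith : 0 ≤ 1 - s i)
      (by ring) (hvi.trans (hwi i hiB)) k hAk
    have upC : ∀ r : α → ℝ, (∀ a, r a ≤ C * w i a) → ∀ j a, Function.update v i r j a ≤ C * w j a := by
      intro r hr j a
      by_cases hj : j = i
      · subst hj; simpa using hr a
      · rw [Function.update_of_ne hj]; exact hvC j a
    have hΦp := hmax _ (hvP.update i hp0 hp1) (upC _ hpC)
    have hΦq := hmax _ (hvP.update i hq0 hq1) (upC _ hqC)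
    set N := Ex v (fun x => (cav (Function.update v i (p i)) (f k) (A k) x
      - cav (Function.update v i (q i)) (f k) (A k) x) ^ 2) with hN
    have hN0 : 0 ≤ N := Ex_nonneg hvP fun x => sq_nonneg _
    have h1C : 1 ≤ C * s i := by
      have := mul_le_mul_of_nonneg_left hs1 hCpos.le
      rwa [mul_one_div_cancel hCpos.ne'] at this
    set D := Phi f A w + η - Phi f A v with hD
    set Dp := Phi f A w + η - Phi f A (Function.update v i (p i)) with hDp
    have hDp0 : 0 ≤ Dp := by linarith
    have hmain : s i * Dp + s i * (1 - s i) * N ≤ D := by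
      nlinarith
    have hbound : C * D ≤ C ^ (B.card + 1) * η := by
      rw [pow_succ]; nlinarith
    have h2 : 0 ≤ s i * (1 - s i) * N :=
      mul_nonneg (mul_nonneg hspos.le (by linarith)) hN0
    have hD0 : 0 ≤ D := by nlinarith [mul_nonneg hspos.le hDp0]
    constructor
    · rw [hins, card_insert_of_notMem hi]
      refine le_trans ?_ hbound
      show Dp ≤ C * D
      nlinarith [mul_nonneg hspos.le hDp0]
    · rw [hins, card_insert_of_notMem hi]
      have hexp : ∀ x, cav v (f k) (A k) x = s i * cav (Function.update v i (p i)) (f k) (A k) x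
          + (1 - s i) * cav (Function.update v i (q i)) (f k) (A k) x := by
        intro x
        unfold cav
        rw [← Ex_update_linear, ← hwi i hiB, ← hvi, Function.update_eq_self]
      have hdep : Dep (fun x => |cav (Function.update v i (p i)) (f k) (A k) x
          - cav v (f k) (A k) x|) (A k) := by
        intro x y h
        show |_ - _| = |_ - _|
        rw [cav_dep _ _ _ x y h, cav_dep _ _ _ x y h]
      have hch : Ex w (fun x => |cav (Function.update v i (p i)) (f k) (A k) x
          - cav v (f k) (A k) x|) = Ex v (fun x => |cav (Function.update v i (p i)) (f k) (A k) x
          - cav v (f k) (A k) x|) := by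
        refine Ex_congr_dep hw hvP hdep fun j hj => ?_
        have : j ∉ B := fun h => disjoint_left.mp hB (mem_insert_of_mem h) hj
        simp only [hv, piecewise_eq_of_notMem _ _ _ this]
      have hstep : Ex w (fun x => |cav (Function.update v i (p i)) (f k) (A k) x
          - cav v (f k) (A k) x|) ≤ √(C ^ (Fintype.card ι) * η) := by
        rw [hch]
        apply Real.le_sqrt_of_sq_le
        refine (Ex_sq_le hvP _).trans ?_
        have e : (fun x => |cav (Function.update v i (p i)) (f k) (A k) x
          - cav v (f k) (A k) x| ^ 2) = fun x => (1 - s i) ^ 2 * (cav (Function.update v i (p i)) (f k) (A k) x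
      - cav (Function.update v i (q i)) (f k) (A k) x) ^ 2 := by
          funext x
          rw [sq_abs, hexp x]; ring
        rw [e, Ex_mul_left, ← hN]
        have hc : B.card + 1 ≤ Fintype.card ι := by
          rw [← card_insert_of_notMem hi]; exact card_le_univ _
        have h3 : C ^ (B.card + 1) * η ≤ C ^ (Fintype.card ι) * η :=
          mul_le_mul_of_nonneg_right (pow_le_pow_right₀ (by linarith) hc) hη.le
        refine le_trans ?_ (hbound.trans h3)
        have h4 : (1 - s i) ^ 2 * N ≤ (1 - s i) * N := by
          have h0 : 0 ≤ 1 - s i := by linarith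
          have : (1 - s i) ^ 2 ≤ 1 - s i := by nlinarith
          exact mul_le_mul_of_nonneg_right this hN0
        have h5 : s i * ((1 - s i) * N) ≤ D := by
          nlinarith [mul_nonneg hspos.le hDp0]
        have h6 : 0 ≤ (1 - s i) * N := mul_nonneg (by linarith) hN0
        have h7 : C * (s i * ((1 - s i) * N)) ≤ C * D := mul_le_mul_of_nonneg_left h5 hCpos.le
        nlinarith
      have htri : Ex w (fun x => |cav (Function.update v i (p i)) (f k) (A k) x
          - cav w (f k) (A k) x|) ≤ Ex w (fun x => |cav (Function.update v i (p i)) (f k) (A k) x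
          - cav v (f k) (A k) x|) + Ex w (fun x => |cav v (f k) (A k) x - cav w (f k) (A k) x|) := by
        rw [← Ex_add]
        exact Ex_mono hw fun x => abs_sub_le _ _ _
      push_cast
      linarith

theorem Ex_tilt (w p u : ι → α → ℝ) (l : ι → ℝ) (B : Finset ι)
    (h : ∀ i ∈ B, ∀ a, w i a * u i a = l i * p i a) (G : (ι → α) → ℝ) :
    Ex w (fun y => G y * ∏ i ∈ B, u i (y i)) = (∏ i ∈ B, l i) * Ex (B.piecewise p w) G := by
  unfold Ex
  rw [mul_sum]
  refine sum_congr rfl fun x _ => ?_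
  have e1 : ∏ i, w i (x i) = (∏ i ∈ B, w i (x i)) * ∏ i ∈ univ \ B, w i (x i) := by
    rw [mul_comm, prod_sdiff (subset_univ B)]
  have e2 : ∏ i, B.piecewise p w i (x i) = (∏ i ∈ B, p i (x i)) * ∏ i ∈ univ \ B, w i (x i) := by
    rw [mul_comm, ← prod_sdiff (subset_univ B)]
    congr 1
    · refine prod_congr rfl fun i hi => ?_
      rw [piecewise_eq_of_notMem _ _ _ (by simpa using hi)]
    · refine prod_congr rfl fun i hi => ?_
      rw [piecewise_eq_of_mem _ _ _ hi]
  have e3 : (∏ i ∈ B, w i (x i)) * ∏ i ∈ B, u i (x i) = (∏ i ∈ B, l i) * ∏ i ∈ B, p i (x i) := by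
    rw [← prod_mul_distrib, ← prod_mul_distrib]
    exact prod_congr rfl fun i hi => h i hi _
  rw [e1, e2]
  linear_combination (∏ i ∈ univ \ B, w i (x i)) * G x * e3

/-- the regularity property. -/
def RegProp (w : ι → α → ℝ) (f : (ι → α) → ℝ) (A : Finset ι) (δ : ℝ) : Prop :=
  ∀ B : Finset ι, Disjoint B A → ∀ u : ι → α → ℝ, (∀ i a, 0 ≤ u i a ∧ u i a ≤ 1) →
    Ex w (fun x => |Ex w (fun y => f (A.piecewise x y) * ∏ i ∈ B, u i (y i))
      - (∏ i ∈ B, Ex w (fun y => u i (y i))) * cav w f A x|) ≤ δ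

theorem reg_of_nearmax (f : κ → (ι → α) → ℝ) (A : κ → Finset ι) {w : ι → α → ℝ} (hw : IsP w)
    (hf : ∀ k x, 0 ≤ f k x ∧ f k x ≤ 1)
    {η C δ : ℝ} (hη : 0 < η) (hC : 2 ≤ C) (hCδ : 2 / C ≤ δ)
    (hδ : Fintype.card ι * √(C ^ (Fintype.card ι) * η) ≤ δ)
    (hmax : ∀ w', IsP w' → (∀ i a, w' i a ≤ C * w i a) → Phi f A w' ≤ Phi f A w + η)
    (k : κ) : RegProp w (f k) (A k) δ := by
  intro B hB u hu
  have hCpos : 0 < C := by linarith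
  set m : ι → ℝ := fun i => Ex w (fun y => u i (y i)) with hm
  have hm0 : ∀ i, 0 ≤ m i := fun i => Ex_nonneg hw fun y => (hu i _).1
  have hm1 : ∀ i, m i ≤ 1 := fun i => Ex_le hw fun y => (hu i _).2
  have hg0 := fun x => cav_nonneg hw (fun x => (hf k x).1) (A k) x
  have hg1 := fun x => cav_le_one hw (fun x => (hf k x).2) (A k) x
  by_cases hsmall : ∃ i ∈ B, m i < 2 / C
  · obtain ⟨i, hi, hlt⟩ := hsmall
    refine (Ex_le hw (c := 2 / C) fun x => ?_).trans hCδ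
    have hprod : ∀ v : ι → ℝ, (∀ j, 0 ≤ v j ∧ v j ≤ 1) → ∏ j ∈ B, v j ≤ v i := by
      intro v hv
      rw [← mul_prod_erase B _ hi]
      exact mul_le_of_le_one_right (hv i).1
        (prod_le_one (fun j _ => (hv j).1) fun j _ => (hv j).2)
    have h1 : Ex w (fun y => f k ((A k).piecewise x y) * ∏ i ∈ B, u i (y i)) ≤ m i := by
      refine Ex_mono hw fun y => ?_
      refine le_trans ?_ (hprod (fun j => u j (y j)) fun j => hu j _)
      exact mul_le_of_le_one_left (prod_nonneg fun j _ => (hu j _).1) (hf k _).2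
    have h1' : 0 ≤ Ex w (fun y => f k ((A k).piecewise x y) * ∏ i ∈ B, u i (y i)) :=
      Ex_nonneg hw fun y => mul_nonneg (hf k _).1 (prod_nonneg fun j _ => (hu j _).1)
    have h2 : (∏ i ∈ B, m i) * cav w (f k) (A k) x ≤ m i :=
      (mul_le_of_le_one_right (prod_nonneg fun j _ => hm0 j) (hg1 x)).trans
        (hprod m fun j => ⟨hm0 j, hm1 j⟩)
    have h2' : 0 ≤ (∏ i ∈ B, m i) * cav w (f k) (A k) x :=
      mul_nonneg (prod_nonneg fun j _ => hm0 j) (hg0 x)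
    rw [abs_le]; constructor <;> linarith
  · push Not at hsmall
    have hmi : ∀ i, m i = ∑ a, w i a * u i a := fun i => Ex_coord hw i (u i)
    have hmpos : ∀ i ∈ B, 0 < m i := fun i hi => lt_of_lt_of_le (by positivity) (hsmall i hi)
    set p : ι → α → ℝ := fun i a => w i a * u i a / m i with hpdef
    set q : ι → α → ℝ := fun i a => w i a * (1 - u i a / 2) / (1 - m i / 2) with hqdef
    have hreg := (reg_induct f A hw hη hC hmax k p q (fun i => m i / 2) B hB ?_ ?_ ?_ ?_).2
    · have hid : ∀ x, Ex w (fun y => f k ((A k).piecewise x y) * ∏ i ∈ B, u i (y i))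
          = (∏ i ∈ B, m i) * cav (B.piecewise p w) (f k) (A k) x := by
        intro x
        unfold cav
        refine Ex_tilt w p u m B (fun i hi a => ?_) _
        have := (hmpos i hi).ne'
        simp only [hpdef]; field_simp
      have hP0 : 0 ≤ ∏ i ∈ B, m i := prod_nonneg fun j _ => hm0 j
      have hP1 : ∏ i ∈ B, m i ≤ 1 := prod_le_one (fun j _ => hm0 j) fun j _ => hm1 j
      refine le_trans (Ex_mono hw fun x => ?_) (hreg.trans (le_trans ?_ hδ))
      · rw [hid x, ← mul_sub, abs_mul, abs_of_nonneg hP0]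
        exact mul_le_of_le_one_left (abs_nonneg _) hP1
      · gcongr
        exact card_le_univ B
    · intro i hi
      have hpos := hmpos i hi
      refine ⟨fun a => div_nonneg (mul_nonneg ((hw i).1 a) (hu i a).1) hpos.le, ?_, fun a => ?_⟩
      · simp only [hpdef]
        rw [← sum_div, ← hmi, div_self hpos.ne']
      · simp only [hpdef]
        rw [div_le_iff₀ hpos]
        have h3 : 2 ≤ C * m i := by
          have := hsmall i hi
          rw [div_le_iff₀ hCpos] at this
          linarith
        nlinarith [(hw i).1 a, (hu i a).1, (hu i a).2, mul_nonneg ((hw i).1 a) (sub_nonneg.mpr (hu i a).2),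
          mul_nonneg ((hw i).1 a) (sub_nonneg.mpr h3)]
    · intro i hi
      have hpos := hmpos i hi
      have h1 := hm1 i
      have hq' : 0 < 1 - m i / 2 := by linarith
      refine ⟨fun a => div_nonneg (mul_nonneg ((hw i).1 a) (by linarith [(hu i a).2])) hq'.le, ?_, fun a => ?_⟩
      · simp only [hqdef]
        rw [← sum_div, div_eq_one_iff_eq hq'.ne']
        have : ∀ a, w i a * (1 - u i a / 2) = w i a - (w i a * u i a) / 2 := fun a => by ring
        simp_rw [this]
        rw [sum_sub_distrib, (hw i).2, ← sum_div, ← hmi]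
      · simp only [hqdef]
        rw [div_le_iff₀ hq']
        nlinarith [(hw i).1 a, (hu i a).1, mul_nonneg ((hw i).1 a) (hu i a).1,
          mul_nonneg ((hw i).1 a) (mul_nonneg hCpos.le hq'.le),
          mul_nonneg ((hw i).1 a) (by nlinarith : 0 ≤ C * (1 - m i / 2) - 1)]
    · intro i hi
      have := hsmall i hi
      have h1 := hm1 i
      constructor
      · have : 1 / C = (2 / C) / 2 := by ring
        show 1 / C ≤ m i / 2
        linarith
      · show m i / 2 ≤ 1
        linarith
    · intro i hi
      funext a
      have hpos := (hmpos i hi).ne'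
      have h1 := hm1 i
      have hq' : 1 - m i / 2 ≠ 0 := by
        have : 0 < 1 - m i / 2 := by linarith
        exact this.ne'
      simp only [hpdef, hqdef]
      rw [mul_div_cancel₀ _ hq']
      field_simp
      ring

theorem exists_regular (ι κ : Type*) [Fintype ι] [DecidableEq ι] [Fintype κ] (δ : ℝ) (hδ : 0 < δ) :
    ∃ M : ℝ, 1 ≤ M ∧ ∀ (α : Type) [Fintype α] (f : κ → (ι → α) → ℝ) (A : κ → Finset ι)
      (w0 : ι → α → ℝ), IsP w0 → (∀ k x, 0 ≤ f k x ∧ f k x ≤ 1) →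
      ∃ w, IsP w ∧ (∀ i a, w i a ≤ M * w0 i a) ∧ ∀ k, RegProp w (f k) (A k) δ := by
  set C : ℝ := 2 + 2 / δ with hCdef
  have hC : 2 ≤ C := by have : 0 < 2 / δ := by positivity
                        linarith
  have hCpos : 0 < C := by linarith
  have hCδ : 2 / C ≤ δ := by
    rw [div_le_iff₀ hCpos, hCdef, mul_add, mul_div_cancel₀ _ hδ.ne']
    linarith
  set K := Fintype.card ι with hK
  set η : ℝ := (δ / (K + 1)) ^ 2 / C ^ K with hη
  have hηpos : 0 < η := by positivity
  have hsq : (K : ℝ) * √(C ^ K * η) ≤ δ := by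
    have : C ^ K * η = (δ / (K + 1)) ^ 2 := by rw [hη]; field_simp
    rw [this, Real.sqrt_sq (by positivity), mul_div_assoc', div_le_iff₀ (by positivity)]
    nlinarith
  obtain ⟨J, hJ⟩ := exists_nat_gt ((Fintype.card κ : ℝ) / η)
  rw [div_lt_iff₀ hηpos] at hJ
  refine ⟨C ^ J, one_le_pow₀ (by linarith), ?_⟩
  intro α _ f A w0 hw0 hf
  have hP0 : ∀ w, IsP w → 0 ≤ Phi f A w := by
    intro w hw
    exact sum_nonneg fun k _ => Ex_nonneg hw fun x => sq_nonneg _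
  have hP1 : ∀ w, IsP w → Phi f A w ≤ (Fintype.card κ : ℝ) := by
    intro w hw
    have : Phi f A w ≤ ∑ k : κ, (1 : ℝ) := by
      refine sum_le_sum fun k _ => Ex_le hw fun x => ?_
      have h0 := cav_nonneg hw (fun x => (hf k x).1) (A k) x
      have h1 := cav_le_one hw (fun x => (hf k x).2) (A k) x
      nlinarith
    simpa using this
  obtain ⟨w, hw, hwC, hmax⟩ := exists_nearmax (Phi f A) hηpos hP0 hP1 (by linarith : 1 ≤ C) J hJ w0 hw0
  exact ⟨w, hw, hwC, fun k => reg_of_nearmax f A hw hf hηpos hC hCδ hsq hmax k⟩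

end Energy

end UTD

namespace UTD
open Finset

/-! ### Replacing a function by its conditional average -/
section Replace
variable {ι α : Type*} [Fintype ι] [DecidableEq ι] [Fintype α]

/-- regularity for a fixed test set. -/
def RegOn (w : ι → α → ℝ) (f : (ι → α) → ℝ) (A B : Finset ι) (δ : ℝ) : Prop :=
  ∀ u : ι → α → ℝ, (∀ i a, 0 ≤ u i a ∧ u i a ≤ 1) →
    Ex w (fun x => |Ex w (fun y => f (A.piecewise x y) * ∏ i ∈ B, u i (y i))
      - (∏ i ∈ B, Ex w (fun y => u i (y i))) * cav w f A x|) ≤ δ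

theorem replace_aux {κ : Type*} [DecidableEq κ] {w : ι → α → ℝ} (hw : IsP w) {f : (ι → α) → ℝ}
    {A X : Finset ι} {δ : ℝ} (hreg : RegOn w f A X δ) (hf : Dep f (A ∪ X)) (hAX : Disjoint A X)
    (s : Finset κ) (V : κ → (ι → α) → ℝ) (hV : ∀ k x, 0 ≤ V k x ∧ V k x ≤ 1)
    (D : κ → Finset ι) (hD : ∀ k, Dep (V k) (D k)) (c : κ → Option ι)
    (hc0 : ∀ k ∈ s, c k = none → Disjoint (D k) X)
    (hc1 : ∀ k ∈ s, ∀ i, c k = some i → i ∈ X ∧ D k ∩ (A ∪ X) ⊆ {i}) :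
    |Ex w (fun x => f x * ∏ k ∈ s, V k x) - Ex w (fun x => cav w f A x * ∏ k ∈ s, V k x)| ≤ δ := by
  classical
  set O : Finset ι := univ \ (A ∪ X) with hO
  set W0 : (ι → α) → ℝ := fun x => ∏ k ∈ s with c k = none, V k x with hW0
  set u : (ι → α) → ι → α → ℝ := fun z i a =>
    ∏ k ∈ s with c k = some i, V k (Function.update z i a) with hu
  have hW01 : ∀ x, 0 ≤ W0 x ∧ W0 x ≤ 1 := fun x =>
    ⟨prod_nonneg fun k _ => (hV k x).1, prod_le_one (fun k _ => (hV k x).1) fun k _ => (hV k x).2⟩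
  have hu1 : ∀ z i a, 0 ≤ u z i a ∧ u z i a ≤ 1 := fun z i a =>
    ⟨prod_nonneg fun k _ => (hV k _).1, prod_le_one (fun k _ => (hV k _).1) fun k _ => (hV k _).2⟩
  have hprod : ∀ z x y : ι → α, ∏ k ∈ s, V k (O.piecewise z (A.piecewise x y))
      = W0 (O.piecewise z x) * ∏ i ∈ X, u z i (y i) := by
    intro z x y
    rw [← prod_fiberwise_of_maps_to (s := s) (t := Finset.insertNone X) (g := c)]
    · rw [Finset.prod_insertNone]
      congr 1
      · refine prod_congr rfl fun k hk => ?_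
        simp only [mem_filter] at hk
        refine hD k _ _ fun i hi => ?_
        have hiX := Finset.disjoint_left.1 (hc0 k hk.1 hk.2) hi
        by_cases h1 : i ∈ O
        · simp [h1]
        · have : i ∈ A := by
            simp [hO] at h1; tauto
          simp [h1, this]
      · refine prod_congr rfl fun i hi => prod_congr rfl fun k hk => ?_
        simp only [mem_filter] at hk
        refine hD k _ _ fun j hj => ?_
        by_cases h1 : j ∈ O
        · have hji : j ≠ i := by
            rintro rfl
            simp [hO, hi] at h1
          simp [h1, hji]
        · have h2 : j ∈ A ∪ X := by by_contra h; exact h1 (by rw [hO]; simp only [mem_sdiff, mem_univ, true_and]; exact h)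
          have h3 := (hc1 k hk.1 i hk.2).2 (mem_inter.2 ⟨hj, h2⟩)
          simp only [mem_singleton] at h3
          subst h3
          have : j ∉ A := Finset.disjoint_right.1 hAX hi
          simp [h1, this]
    · intro k hk
      rw [Finset.mem_insertNone]
      intro i hi
      exact (hc1 k hk i hi).1
  have hfO : ∀ z x y : ι → α, f (O.piecewise z (A.piecewise x y)) = f (A.piecewise x y) := by
    intro z x y
    refine hf _ _ fun i hi => ?_
    have : i ∉ O := by rw [hO]; simp only [mem_sdiff, mem_univ, true_and, not_not]; exact hi
    simp [this]
  have hcO : ∀ z x y : ι → α, cav w f A (O.piecewise z (A.piecewise x y)) = cav w f A x := by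
    intro z x y
    refine cav_dep w f A _ _ fun i hi => ?_
    have : i ∉ O := by simp [hO, hi]
    simp [this, hi]
  have e1 : ∀ G : (ι → α) → ℝ, Ex w G = Ex w (fun z => Ex w (fun x => Ex w (fun y =>
      G (O.piecewise z (A.piecewise x y))))) := by
    intro G
    rw [← Ex_resample hw O G]
    congr 1
    funext z
    rw [← Ex_resample hw A]
  rw [e1 (fun x => f x * ∏ k ∈ s, V k x), e1 (fun x => cav w f A x * ∏ k ∈ s, V k x)]
  simp only [hprod, hfO, hcO]
  rw [← Ex_sub]
  refine (abs_Ex_le hw _).trans (Ex_le hw fun z => ?_)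
  rw [← Ex_sub]
  refine (abs_Ex_le hw _).trans (le_trans (Ex_mono hw fun x => ?_) (hreg (u z) (hu1 z)))
  have e2 : Ex w (fun y => f (A.piecewise x y) * (W0 (O.piecewise z x) * ∏ i ∈ X, u z i (y i)))
      = W0 (O.piecewise z x) * Ex w (fun y => f (A.piecewise x y) * ∏ i ∈ X, u z i (y i)) := by
    rw [← Ex_mul_left]; congr 1; funext y; ring
  have e3 : Ex w (fun y => cav w f A x * (W0 (O.piecewise z x) * ∏ i ∈ X, u z i (y i)))
      = W0 (O.piecewise z x) * ((∏ i ∈ X, Ex w fun y => u z i (y i)) * cav w f A x) := by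
    rw [← Ex_prod_coord hw, ← Ex_mul_right, ← Ex_mul_left]; congr 1; funext y; ring
  rw [e2, e3, ← mul_sub, abs_mul, abs_of_nonneg (hW01 _).1]
  exact mul_le_of_le_one_left (abs_nonneg _) (hW01 _).2

theorem replace_cav {κ : Type*} [DecidableEq κ] {w : ι → α → ℝ} (hw : IsP w) {f : (ι → α) → ℝ}
    {A X : Finset ι} {δ : ℝ} (hreg : RegOn w f A X δ) (hf : Dep f (A ∪ X)) (hAX : Disjoint A X)
    (s : Finset κ) (V : κ → (ι → α) → ℝ) (hV : ∀ k x, 0 ≤ V k x ∧ V k x ≤ 1)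
    (D : κ → Finset ι) (hD : ∀ k, Dep (V k) (D k))
    (hc : ∀ k ∈ s, Disjoint (D k) X ∨ ∃ i ∈ X, D k ∩ (A ∪ X) ⊆ {i}) :
    |Ex w (fun x => f x * ∏ k ∈ s, V k x) - Ex w (fun x => cav w f A x * ∏ k ∈ s, V k x)| ≤ δ := by
  classical
  refine replace_aux hw hreg hf hAX s V hV D hD
    (fun k => if h : Disjoint (D k) X then none else
      if h' : ∃ i ∈ X, D k ∩ (A ∪ X) ⊆ {i} then some h'.choose else none) ?_ ?_
  · intro k hk h
    by_contra h1
    have h2 := (hc k hk).resolve_left h1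
    simp only [h1, h2, dite_true, dite_false] at h
    exact absurd h (by simp)
  · intro k hk i h
    by_cases h1 : Disjoint (D k) X
    · simp [h1] at h
    · have h2 := (hc k hk).resolve_left h1
      simp only [h1, h2, dite_true, dite_false, Option.some.injEq] at h
      rw [← h]
      exact h2.choose_spec

/-- conditional independence: averages over `X` and `Y` given `Z`. -/
theorem Ex_cav_mul {w : ι → α → ℝ} (hw : IsP w) {f g : (ι → α) → ℝ} {Z X Y : Finset ι}
    (hf : Dep f (Z ∪ X)) (hg : Dep g (Z ∪ Y)) (hXY : Disjoint X Y)
    (hZX : Disjoint Z X) (hZY : Disjoint Z Y) {u : (ι → α) → ℝ} (hu : Dep u Z) :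
    Ex w (fun x => f x * g x * u x) = Ex w (fun x => cav w f Z x * cav w g Z x * u x) := by
  rw [← Ex_resample hw Z]
  congr 1
  funext x
  have h1 : Dep (fun y => f (Z.piecewise x y)) X := by
    intro y y' h
    refine hf _ _ fun i hi => ?_
    by_cases hiZ : i ∈ Z
    · simp [hiZ]
    · simp [hiZ]; exact h i (by simpa [hiZ] using hi)
  have h2 : Dep (fun y => g (Z.piecewise x y)) Y := by
    intro y y' h
    refine hg _ _ fun i hi => ?_
    by_cases hiZ : i ∈ Z
    · simp [hiZ]
    · simp [hiZ]; exact h i (by simpa [hiZ] using hi)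
  have h3 : ∀ y, u (Z.piecewise x y) = u x := fun y => hu _ _ fun i hi => by simp [hi]
  simp only [h3]
  rw [Ex_mul_right]
  show _ = cav w f Z x * cav w g Z x * u x
  rw [Ex_mul_indep hw h1 h2 hXY]
  rfl

/-- one-sided conditional averaging. -/
theorem Ex_cav_one {w : ι → α → ℝ} (hw : IsP w) {f u : (ι → α) → ℝ} {Z : Finset ι}
    (hu : Dep u Z) :
    Ex w (fun x => f x * u x) = Ex w (fun x => cav w f Z x * u x) := by
  rw [← Ex_resample hw Z]
  congr 1
  funext x
  have h3 : ∀ y, u (Z.piecewise x y) = u x := fun y => hu _ _ fun i hi => by simp [hi]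
  simp only [h3]
  rw [Ex_mul_right]
  rfl

theorem twin_step {κ : Type*} [DecidableEq κ] {w : ι → α → ℝ} (hw : IsP w) {f g : (ι → α) → ℝ}
    {Z X Y : Finset ι} {δ : ℝ} (hf01 : ∀ x, 0 ≤ f x ∧ f x ≤ 1) (hg01 : ∀ x, 0 ≤ g x ∧ g x ≤ 1)
    (hrf : RegProp w f Z δ) (hrg : RegProp w g Z δ) (hrfg : RegProp w (fun x => f x * g x) ∅ δ)
    (hf : Dep f (Z ∪ X)) (hg : Dep g (Z ∪ Y)) (hXY : Disjoint X Y)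
    (hZX : Disjoint Z X) (hZY : Disjoint Z Y)
    (s : Finset κ) (V : κ → (ι → α) → ℝ) (hV : ∀ k x, 0 ≤ V k x ∧ V k x ≤ 1)
    (D : κ → Finset ι) (hD : ∀ k, Dep (V k) (D k))
    (hc1 : ∀ k ∈ s, (D k ∩ (Z ∪ X)).card ≤ 1) (hc2 : ∀ k ∈ s, (D k ∩ (Z ∪ Y)).card ≤ 1) :
    Ex w (fun x => f x * g x) * Ex w (fun x => ∏ k ∈ s, V k x) - 3 * δ
      ≤ Ex w (fun x => f x * g x * ∏ k ∈ s, V k x) := by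
  classical
  have aux : ∀ (E : Finset ι) (A B : Finset ι), (E ∩ (A ∪ B)).card ≤ 1 →
      Disjoint E B ∨ ∃ i ∈ B, E ∩ (A ∪ B) ⊆ {i} := by
    intro E A B h
    by_cases h1 : Disjoint E B
    · exact Or.inl h1
    · right
      rw [Finset.not_disjoint_iff] at h1
      obtain ⟨i, hiE, hiB⟩ := h1
      refine ⟨i, hiB, fun j hj => ?_⟩
      rw [mem_singleton]
      exact Finset.card_le_one.1 h j hj i (by simp [hiE, hiB])
  set cf := cav w f Z with hcf
  set cg := cav w g Z with hcg
  have s1 := replace_cav hw (hrf X hZX.symm) hf hZX (Finset.insertNone s)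
    (fun o => o.elim g V) (by rintro (_ | k) x; exacts [hg01 x, hV k x])
    (fun o => o.elim (Z ∪ Y) D) (by rintro (_ | k); exacts [hg, hD k]) (by
      rintro (_ | k) hk
      · left
        exact Finset.disjoint_union_left.2 ⟨hZX, hXY.symm⟩
      · exact aux _ _ _ (hc1 k (by simpa using hk)))
  have s2 := replace_cav hw (hrg Y hZY.symm) hg hZY (Finset.insertNone s)
    (fun o => o.elim cf V) (by
      rintro (_ | k) x
      exacts [⟨cav_nonneg hw (fun x => (hf01 x).1) Z x, cav_le_one hw (fun x => (hf01 x).2) Z x⟩, hV k x])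
    (fun o => o.elim Z D) (by rintro (_ | k); exacts [cav_dep w f Z, hD k]) (by
      rintro (_ | k) hk
      · left
        exact hZY
      · exact aux _ _ _ (hc2 k (by simpa using hk)))
  have hcc : Ex w (fun x => cf x * cg x) = Ex w (fun x => f x * g x) := by
    have := Ex_cav_mul hw hf hg hXY hZX hZY (u := fun _ => 1) (fun _ _ _ => rfl)
    simpa using this.symm
  have s3 := replace_cav hw (f := fun x => cf x * cg x) (A := ∅) (X := Z) (δ := δ) (by
      intro u hu
      refine le_trans (le_of_eq ?_) (hrfg Z (by simp) u hu)
      congr 1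
      funext x
      simp only [cav, Finset.piecewise_empty]
      have h1 := Ex_cav_mul hw hf hg hXY hZX hZY (u := fun y => ∏ i ∈ Z, u i (y i))
        (fun x y h => prod_congr rfl fun i hi => by rw [h i hi])
      rw [h1]
      have h2 : Ex w (fun y => cf y * cg y) = Ex w (fun y => f y * g y) := hcc
      rw [h2])
    (by
      rw [empty_union]
      exact (cav_dep w f Z).mul (cav_dep w g Z)) (by simp) s V hV D hD (by
      intro k hk
      apply aux
      refine le_trans (card_le_card ?_) (hc1 k hk)
      rw [empty_union]
      exact inter_subset_inter_left subset_union_left)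
  simp only [Finset.prod_insertNone, Option.elim] at s1 s2
  simp only [cav, Finset.piecewise_empty] at s3
  rw [hcc, Ex_mul_left] at s3
  have e1 : Ex w (fun x => f x * g x * ∏ k ∈ s, V k x) = Ex w (fun x => f x * (g x * ∏ k ∈ s, V k x)) := by
    congr 1; funext x; ring
  have e2 : Ex w (fun x => cf x * (g x * ∏ k ∈ s, V k x)) = Ex w (fun x => g x * (cf x * ∏ k ∈ s, V k x)) := by
    congr 1; funext x; ring
  have e3 : Ex w (fun x => cg x * (cf x * ∏ k ∈ s, V k x)) = Ex w (fun x => cf x * cg x * ∏ k ∈ s, V k x) := by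
    congr 1; funext x; ring
  rw [e2] at s1
  rw [e3] at s2
  rw [e1]
  have t1 := (abs_le.1 s1).1
  have t2 := (abs_le.1 s2).1
  have t3 := (abs_le.1 s3).1
  linarith

end Replace
end UTD

namespace UTD
open Finset

section PairsCount
variable {ι α : Type*} [Fintype ι] [DecidableEq ι] [Fintype α]

theorem pairs_count {κ : Type*} [DecidableEq κ] {w : ι → α → ℝ} (hw : IsP w)
    (T : κ → Bool → Finset ι) (f : κ → Bool → (ι → α) → ℝ)
    (hf01 : ∀ k b x, 0 ≤ f k b x ∧ f k b x ≤ 1) (hf : ∀ k b, Dep (f k b) (T k b))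
    {c δ : ℝ} (hc0 : 0 ≤ c) (hc1 : c ≤ 1) (hδ : 0 ≤ δ) (s : Finset κ)
    (h1 : ∀ k ∈ s, ∀ b, RegProp w (f k b) (T k false ∩ T k true) δ)
    (h2 : ∀ k ∈ s, RegProp w (fun x => f k false x * f k true x) ∅ δ)
    (h3 : ∀ k ∈ s, c ≤ Ex w (fun x => f k false x * f k true x))
    (h4 : ∀ k ∈ s, ∀ l ∈ s, k ≠ l → ∀ b b', (T k b ∩ T l b').card ≤ 1) :
    c ^ s.card - 3 * δ * s.card ≤ Ex w (fun x => ∏ k ∈ s, (f k false x * f k true x)) := by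
  induction s using Finset.induction_on with
  | empty => simp [Ex_const hw]
  | insert k s hk ih =>
    have ih' := ih (fun k hk => h1 k (mem_insert_of_mem hk)) (fun k hk => h2 k (mem_insert_of_mem hk))
      (fun k hk => h3 k (mem_insert_of_mem hk))
      (fun k hk l hl => h4 k (mem_insert_of_mem hk) l (mem_insert_of_mem hl))
    have hks := mem_insert_self k s
    have hne : ∀ l ∈ s, l ≠ k := fun l hl h => hk (h ▸ hl)
    have st := twin_step hw (hf01 k false) (hf01 k true) (h1 k hks false) (h1 k hks true) (h2 k hks)
      (X := T k false \ T k true) (Y := T k true \ T k false)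
      ((hf k false).mono (by intro i; simp; tauto)) ((hf k true).mono (by intro i; simp; tauto))
      (by rw [Finset.disjoint_left]; intro i; simp; tauto)
      (by rw [Finset.disjoint_left]; intro i; simp; tauto)
      (by rw [Finset.disjoint_left]; intro i; simp; tauto)
      (s ×ˢ (univ : Finset Bool)) (fun p => f p.1 p.2) (fun p => hf01 p.1 p.2)
      (fun p => T p.1 p.2) (fun p => hf p.1 p.2)
      (by
        rintro ⟨l, b⟩ hl
        have hl' : l ∈ s := by simpa using hl
        refine le_trans (card_le_card ?_) (h4 l (mem_insert_of_mem hl') k hks (hne l hl') b false)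
        intro i; simp; tauto)
      (by
        rintro ⟨l, b⟩ hl
        have hl' : l ∈ s := by simpa using hl
        refine le_trans (card_le_card ?_) (h4 l (mem_insert_of_mem hl') k hks (hne l hl') b true)
        intro i; simp; tauto)
    have e : ∀ x, ∏ p ∈ s ×ˢ (univ : Finset Bool), f p.1 p.2 x = ∏ l ∈ s, (f l false x * f l true x) := by
      intro x
      rw [prod_product]
      refine prod_congr rfl fun l _ => ?_
      rw [Fintype.prod_bool, mul_comm]
    simp only [e] at st
    simp only [prod_insert hk]
    rw [card_insert_of_notMem hk, pow_succ]
    push_cast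
    have hc := h3 k hks
    have hE0 : 0 ≤ Ex w (fun x => ∏ l ∈ s, (f l false x * f l true x)) :=
      Ex_nonneg hw fun x => prod_nonneg fun l _ => mul_nonneg (hf01 _ _ _).1 (hf01 _ _ _).1
    have m1 := mul_le_mul_of_nonneg_right hc hE0
    have m2 := mul_le_mul_of_nonneg_left ih' hc0
    have m3 : c * (3 * δ * s.card) ≤ 3 * δ * s.card := mul_le_of_le_one_left (by positivity) hc1
    nlinarith

/-- two coordinates rarely coincide. -/
theorem Ex_coincide {w : ι → α → ℝ} (hw : IsP w) [DecidableEq α] {i j : ι} (hij : i ≠ j) {t : ℝ}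
    (ht : ∀ a, w i a ≤ t) : Ex w (fun x => if x i = x j then 1 else 0) ≤ t := by
  rw [← Ex_resample hw {j}]
  refine Ex_le hw fun x => ?_
  have : ∀ y : ι → α, ((if ({j} : Finset ι).piecewise x y i = ({j} : Finset ι).piecewise x y j then 1 else 0 : ℝ))
      = (fun a => if a = x j then (1:ℝ) else 0) (y i) := by
    intro y
    simp [hij]
  simp only [this]
  rw [Ex_coord hw i (fun a => if a = x j then (1:ℝ) else 0)]
  simp [ht]

theorem Ex_noninj {w : ι → α → ℝ} (hw : IsP w) [DecidableEq α] {t : ℝ} (ht0 : 0 ≤ t)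
    (ht : ∀ i a, w i a ≤ t) :
    Ex w (fun x => if Function.Injective x then 0 else 1) ≤ (Fintype.card ι : ℝ) ^ 2 * t := by
  classical
  have : ∀ x : ι → α, (if Function.Injective x then (0:ℝ) else 1)
      ≤ ∑ p ∈ (univ : Finset (ι × ι)).filter (fun p => p.1 ≠ p.2), if x p.1 = x p.2 then (1:ℝ) else 0 := by
    intro x
    split_ifs with h
    · exact sum_nonneg fun p _ => by split_ifs <;> norm_num
    · simp only [Function.Injective, not_forall] at h
      obtain ⟨i, j, hx, hij⟩ := h
      have := single_le_sum (f := fun p : ι × ι => if x p.1 = x p.2 then (1:ℝ) else 0)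
        (s := (univ : Finset (ι × ι)).filter (fun p => p.1 ≠ p.2))
        (fun p _ => by split_ifs <;> norm_num) (a := (i, j)) (by simpa using hij)
      simpa [hx] using this
  refine (Ex_mono hw this).trans ?_
  rw [Ex_sum]
  refine (sum_le_card_nsmul _ _ t fun p hp => ?_).trans ?_
  · exact Ex_coincide hw (by simpa using hp) (ht p.1)
  · rw [nsmul_eq_mul]
    refine mul_le_mul_of_nonneg_right ?_ ht0
    have := card_filter_le (univ : Finset (ι × ι)) (fun p => p.1 ≠ p.2)
    rw [card_univ, Fintype.card_prod] at this
    rw [sq]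
    exact_mod_cast this

end PairsCount

/-! ### Ramsey theorem -/
section Ramsey

theorem ramsey_aux (q : ℕ) : ∀ a b : ℕ, ∃ N : ℕ, ∀ (K : ℕ) (S : Finset (Fin K)) (χ : Finset (Fin K) → Prop), N ≤ S.card →
    (∃ T ⊆ S, T.card = a ∧ ∀ U ⊆ T, U.card = q → χ U) ∨
    (∃ T ⊆ S, T.card = b ∧ ∀ U ⊆ T, U.card = q → ¬ χ U) := by
  induction q with
  | zero =>
    intro a b
    refine ⟨max a b, fun K S χ hS => ?_⟩
    by_cases h : χ ∅
    · left
      obtain ⟨T, hT, hc⟩ := exists_subset_card_eq ((le_max_left a b).trans hS)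
      exact ⟨T, hT, hc, fun U _ hU => by rw [card_eq_zero] at hU; rwa [hU]⟩
    · right
      obtain ⟨T, hT, hc⟩ := exists_subset_card_eq ((le_max_right a b).trans hS)
      exact ⟨T, hT, hc, fun U _ hU => by rw [card_eq_zero] at hU; rwa [hU]⟩
  | succ q ih =>
    have key : ∀ n a b : ℕ, a + b ≤ n → ∃ N : ℕ, ∀ (K : ℕ) (S : Finset (Fin K)) (χ : Finset (Fin K) → Prop), N ≤ S.card →
      (∃ T ⊆ S, T.card = a ∧ ∀ U ⊆ T, U.card = q + 1 → χ U) ∨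
      (∃ T ⊆ S, T.card = b ∧ ∀ U ⊆ T, U.card = q + 1 → ¬ χ U) := by
      intro n
      induction n with
      | zero =>
        intro a b hab
        refine ⟨0, fun K S χ _ => Or.inl ⟨∅, by simp, by simp; omega, fun U hU hc => ?_⟩⟩
        rw [subset_empty] at hU; subst hU; simp at hc
      | succ n ihn =>
        intro a b hab
        rcases Nat.eq_zero_or_pos a with rfl | ha
        · refine ⟨0, fun K S χ _ => Or.inl ⟨∅, by simp, by simp, fun U hU hc => ?_⟩⟩
          rw [subset_empty] at hU; subst hU; simp at hc
        rcases Nat.eq_zero_or_pos b with rfl | hb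
        · refine ⟨0, fun K S χ _ => Or.inr ⟨∅, by simp, by simp, fun U hU hc => ?_⟩⟩
          rw [subset_empty] at hU; subst hU; simp at hc
        obtain ⟨N1, hN1⟩ := ihn (a - 1) b (by omega)
        obtain ⟨N2, hN2⟩ := ihn a (b - 1) (by omega)
        obtain ⟨N, hN⟩ := ih N1 N2
        refine ⟨N + 1, fun K S χ hS => ?_⟩
        obtain ⟨v, hv⟩ : S.Nonempty := by rw [← card_pos]; omega
        have hS' : N ≤ (S.erase v).card := by rw [card_erase_of_mem hv]; omega
        -- extending a monochromatic set by `v`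
        have ext : ∀ (ψ : Finset (Fin K) → Prop) (T' T : Finset (Fin K)), T' ⊆ S.erase v → T ⊆ T' →
            (∀ U ⊆ T', U.card = q → ψ (insert v U)) → (∀ U ⊆ T, U.card = q + 1 → ψ U) →
            ∀ U ⊆ insert v T, U.card = q + 1 → ψ U := by
          intro ψ T' T hT' hT h1 h2 U hU hc
          by_cases hvU : v ∈ U
          · rw [← insert_erase hvU]
            refine h1 _ (fun x hx => ?_) (by rw [card_erase_of_mem hvU]; omega)
            have := hU (mem_of_mem_erase hx)
            rw [mem_insert] at this
            exact hT (this.resolve_left (ne_of_mem_erase hx))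
          · refine h2 U (fun x hx => ?_) hc
            have := hU hx
            rw [mem_insert] at this
            exact this.resolve_left (fun h => hvU (h ▸ hx))
        rcases hN K (S.erase v) (fun U => χ (insert v U)) hS' with ⟨T', hT', hc', hχ⟩ | ⟨T', hT', hc', hχ⟩
        · rcases hN1 K T' χ hc'.ge with ⟨T, hT, hc, hχT⟩ | ⟨T, hT, hc, hχT⟩
          · left
            have hvT : v ∉ T := fun h => (notMem_erase v S) (hT' (hT h))
            refine ⟨insert v T, ?_, by rw [card_insert_of_notMem hvT]; omega, ext χ T' T hT' hT hχ hχT⟩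
            exact insert_subset hv ((hT.trans hT').trans (erase_subset _ _))
          · right
            exact ⟨T, (hT.trans hT').trans (erase_subset _ _), hc, hχT⟩
        · rcases hN2 K T' χ hc'.ge with ⟨T, hT, hc, hχT⟩ | ⟨T, hT, hc, hχT⟩
          · left
            exact ⟨T, (hT.trans hT').trans (erase_subset _ _), hc, hχT⟩
          · right
            have hvT : v ∉ T := fun h => (notMem_erase v S) (hT' (hT h))
            refine ⟨insert v T, ?_, by rw [card_insert_of_notMem hvT]; omega,
              ext (fun U => ¬ χ U) T' T hT' hT hχ hχT⟩
            exact insert_subset hv ((hT.trans hT').trans (erase_subset _ _))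
    exact fun a b => key _ a b le_rfl

end Ramsey
end UTD

namespace UTD
open Finset

section Embed

/-- indicator that the parts in `T` of the point `x` form an edge. -/
def eInd {r K : ℕ} (H : RGraph r) (T : Finset (Fin K)) (x : Fin K → H.verts) : ℝ :=
  if T.image (fun i => (x i : ℕ)) ∈ H.edges then 1 else 0

theorem eInd_01 {r K : ℕ} (H : RGraph r) (T : Finset (Fin K)) (x : Fin K → H.verts) :
    0 ≤ eInd H T x ∧ eInd H T x ≤ 1 := by
  unfold eInd; split_ifs <;> norm_num

theorem eInd_dep {r K : ℕ} (H : RGraph r) (T : Finset (Fin K)) : Dep (eInd H T) T := by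
  intro x y h
  unfold eInd
  rw [Finset.image_congr (g := fun i => (y i : ℕ))]
  intro i hi
  show (x i : ℕ) = y i
  rw [h i hi]

theorem eInd_sq {r K : ℕ} (H : RGraph r) (T : Finset (Fin K)) (x : Fin K → H.verts) :
    eInd H T x * eInd H T x = eInd H T x := by
  unfold eInd; split_ifs <;> norm_num

/-- two index sets overlapping like `X…XZZY…Y`. -/
def Spl (r : ℕ) {K : ℕ} (T1 T2 : Finset (Fin K)) : Prop :=
  T1.card = r ∧ T2.card = r ∧ (T1 ∩ T2).card = 2 ∧
    (∀ a ∈ T1, ∀ b ∈ T2, b ∉ T1 → a < b) ∧ (∀ b ∈ T2, ∀ a ∈ T1, a ∉ T2 → a < b)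

theorem initial_unique {K : ℕ} {Q T T' : Finset (Fin K)} (hT : T ⊆ Q) (hT' : T' ⊆ Q)
    (hc : T.card = T'.card) (h : ∀ a ∈ T, ∀ b ∈ Q, b ∉ T → a < b)
    (h' : ∀ a ∈ T', ∀ b ∈ Q, b ∉ T' → a < b) : T = T' := by
  by_contra hne
  have h1 : ¬ T ⊆ T' := fun hs => hne (eq_of_subset_of_card_le hs hc.ge)
  have h2 : ¬ T' ⊆ T := fun hs => hne (eq_of_subset_of_card_le hs hc.le).symm
  rw [not_subset] at h1 h2
  obtain ⟨x, hx, hx'⟩ := h1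
  obtain ⟨y, hy, hy'⟩ := h2
  exact lt_asymm (h x hx y (hT' hy) hy') (h' y hy x (hT hx) hx')

theorem final_unique {K : ℕ} {Q T T' : Finset (Fin K)} (hT : T ⊆ Q) (hT' : T' ⊆ Q)
    (hc : T.card = T'.card) (h : ∀ a ∈ T, ∀ b ∈ Q, b ∉ T → b < a)
    (h' : ∀ a ∈ T', ∀ b ∈ Q, b ∉ T' → b < a) : T = T' := by
  by_contra hne
  have h1 : ¬ T ⊆ T' := fun hs => hne (eq_of_subset_of_card_le hs hc.ge)
  have h2 : ¬ T' ⊆ T := fun hs => hne (eq_of_subset_of_card_le hs hc.le).symm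
  rw [not_subset] at h1 h2
  obtain ⟨x, hx, hx'⟩ := h1
  obtain ⟨y, hy, hy'⟩ := h2
  exact lt_asymm (h x hx y (hT' hy) hy') (h' y hy x (hT hx) hx')

theorem Spl.unique {r K : ℕ} {T1 T2 S1 S2 : Finset (Fin K)} (h : Spl r T1 T2) (h' : Spl r S1 S2)
    (hu : T1 ∪ T2 = S1 ∪ S2) : T1 = S1 ∧ T2 = S2 := by
  constructor
  · refine initial_unique (Q := T1 ∪ T2) subset_union_left (hu ▸ subset_union_left)
      (h.1.trans h'.1.symm) ?_ ?_
    · intro a ha b hb hb'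
      exact h.2.2.2.1 a ha b ((mem_union.1 hb).resolve_left hb') hb'
    · intro a ha b hb hb'
      rw [hu] at hb
      exact h'.2.2.2.1 a ha b ((mem_union.1 hb).resolve_left hb') hb'
  · refine final_unique (Q := T1 ∪ T2) subset_union_right (hu ▸ subset_union_right)
      (h.2.1.trans h'.2.1.symm) ?_ ?_
    · intro a ha b hb hb'
      exact h.2.2.2.2 a ha b ((mem_union.1 hb).resolve_right hb') hb'
    · intro a ha b hb hb'
      rw [hu] at hb
      exact h'.2.2.2.2 a ha b ((mem_union.1 hb).resolve_right hb') hb'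

theorem Spl.card_union {r K : ℕ} {T1 T2 : Finset (Fin K)} (h : Spl r T1 T2) :
    (T1 ∪ T2).card = 2 * r - 2 := by
  have := card_union_add_card_inter T1 T2
  rw [h.1, h.2.1, h.2.2.1] at this
  omega

theorem Spl.asymm {r K : ℕ} (hr : 3 ≤ r) {T1 T2 : Finset (Fin K)} (h : Spl r T1 T2) (h' : Spl r T2 T1) :
    False := by
  have h1 : (T1 \ T2).Nonempty := by
    rw [← card_pos]
    have := card_sdiff_add_card_inter T1 T2
    rw [h.1, h.2.2.1] at this
    omega
  obtain ⟨a, ha⟩ := h1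
  rw [mem_sdiff] at ha
  obtain ⟨b, hb⟩ : T2.Nonempty := by rw [← card_pos, h.2.1]; omega
  exact lt_asymm (h.2.2.2.2 b hb a ha.1 ha.2) (h'.2.2.2.1 b hb a ha.1 ha.2)

theorem exists_place {K : ℕ} (ord : ℕ → ℕ) (V : Finset ℕ) (U : Finset (Fin K)) (hU : U.card = V.card)
    (hne : V.Nonempty) :
    ∃ j : ℕ → Fin K, (∀ v ∈ V, j v ∈ U) ∧ ∀ u ∈ V, ∀ v ∈ V, ord u < ord v → j u < j v := by
  have hlt : ∀ v ∈ V, (V.filter (fun u => ord u < ord v)).card < V.card := by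
    intro v hv
    apply card_lt_card
    refine ⟨filter_subset _ _, fun h => ?_⟩
    have := h hv
    simp at this
  have hpos : 0 < V.card := card_pos.2 hne
  refine ⟨fun v => U.orderEmbOfFin hU ⟨min (V.filter (fun u => ord u < ord v)).card (V.card - 1),
    by omega⟩, ?_, ?_⟩
  · intro v hv
    exact orderEmbOfFin_mem _ _ _
  · intro u hu v hv huv
    rw [OrderEmbedding.lt_iff_lt, Fin.mk_lt_mk]
    have h1 := hlt u hu
    have h2 := hlt v hv
    have h3 : (V.filter (fun t => ord t < ord u)).card < (V.filter (fun t => ord t < ord v)).card := by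
      apply card_lt_card
      refine ⟨fun t ht => ?_, fun h => ?_⟩
      · rw [mem_filter] at ht ⊢
        exact ⟨ht.1, ht.2.trans huv⟩
      · have := h (mem_filter.2 ⟨hu, huv⟩)
        simp at this
    omega

theorem twin_others {r : ℕ} {F : RGraph r} (hql : QuasiLinear F) {e f : Finset ℕ} (h : IsTwin F e f)
    {f' : Finset ℕ} (hf' : f' ∈ F.edges) (h1 : f' ≠ e) (h2 : f' ≠ f) : (e ∩ f').card ≤ 1 := by
  obtain ⟨f0, hf0, hne, hc, hun⟩ := hql e h.1
  by_cases hff : f = f0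
  · subst hff
    exact hun f' hf' h1 h2
  · have := hun f h.2.1 h.2.2.1.symm hff
    rw [h.2.2.2] at this
    omega

theorem IsTwin.symm' {r : ℕ} {F : RGraph r} {e f : Finset ℕ} (h : IsTwin F e f) : IsTwin F f e :=
  ⟨h.2.1, h.1, h.2.2.1.symm, by rw [inter_comm]; exact h.2.2.2⟩

theorem describes_spl {r K : ℕ} (hr : 3 ≤ r) {F : RGraph r} {ord : ℕ → ℕ} {e f : Finset ℕ} (ht : IsTwin F e f)
    (h : Describes r (headTailSeq r) ord e f) {j : ℕ → Fin K}
    (hj : ∀ u ∈ F.verts, ∀ v ∈ F.verts, ord u < ord v → j u < j v) (hinj : Set.InjOn j F.verts) :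
    Spl r (e.image j) (f.image j) ∨ Spl r (f.image j) (e.image j) := by
  have main : ∀ e f, IsTwin F e f → (∃ w : Fin (2 * r - 2) → ℕ,
    (∀ i j : Fin (2 * r - 2), i < j → ord (w i) < ord (w j)) ∧
    (∀ v : ℕ, v ∈ e ∪ f ↔ ∃ i, w i = v) ∧
    ((∀ i, w i ∈ e ↔ headTailSeq r i ≠ Letter.Y) ∧ (∀ i, w i ∈ f ↔ headTailSeq r i ≠ Letter.X))) →
    Spl r (e.image j) (f.image j) := by
    rintro e f ht ⟨w, hw1, hw2, he, hf⟩
    have hev := F.edges_subset e ht.1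
    have hfv := F.edges_subset f ht.2.1
    have hY : ∀ i, headTailSeq r i = Letter.Y ↔ r ≤ (i : ℕ) := by
      intro i
      unfold headTailSeq
      split_ifs with h1 h2 <;> simp <;> omega
    have hX : ∀ i, headTailSeq r i = Letter.X ↔ (i : ℕ) < r - 2 := by
      intro i
      unfold headTailSeq
      split_ifs with h1 h2 <;> simp <;> omega
    have hmem : ∀ S : Finset ℕ, S ⊆ F.verts → ∀ v ∈ F.verts, j v ∈ S.image j ↔ v ∈ S := by
      intro S hS v hv
      constructor
      · intro h
        obtain ⟨u, hu, huv⟩ := mem_image.1 h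
        rwa [← hinj (hS hu) hv huv]
      · exact fun h => mem_image_of_mem _ h
    refine ⟨?_, ?_, ?_, ?_, ?_⟩
    · rw [card_image_of_injOn (hinj.mono hev), F.edges_card e ht.1]
    · rw [card_image_of_injOn (hinj.mono hfv), F.edges_card f ht.2.1]
    · rw [← image_inter_of_injOn e f (hinj.mono (by simpa using ⟨hev, hfv⟩)),
        card_image_of_injOn (hinj.mono (fun x hx => hev (mem_of_mem_inter_left hx))), ht.2.2.2]
    · intro a ha b hb hb'
      obtain ⟨u, hu, rfl⟩ := mem_image.1 ha
      obtain ⟨v, hv, rfl⟩ := mem_image.1 hb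
      rw [hmem e hev v (hfv hv)] at hb'
      obtain ⟨i, rfl⟩ := (hw2 u).1 (mem_union_left _ hu)
      obtain ⟨i', rfl⟩ := (hw2 v).1 (mem_union_right _ hv)
      rw [he, Ne, hY] at hu hb'
      refine hj _ (hev ((he i).2 (by rw [Ne, hY]; exact hu))) _ (hfv hv) (hw1 _ _ ?_)
      rw [Fin.lt_def]; omega
    · intro b hb a ha ha'
      obtain ⟨u, hu, rfl⟩ := mem_image.1 ha
      obtain ⟨v, hv, rfl⟩ := mem_image.1 hb
      rw [hmem f hfv u (hev hu)] at ha'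
      obtain ⟨i, rfl⟩ := (hw2 u).1 (mem_union_left _ hu)
      obtain ⟨i', rfl⟩ := (hw2 v).1 (mem_union_right _ hv)
      refine hj _ (hev hu) _ (hfv hv) (hw1 _ _ ?_)
      rw [hf, Ne, hX] at hv ha'
      rw [Fin.lt_def]; omega
  obtain ⟨w, h1, h2, h3 | h3⟩ := h
  · exact Or.inl (main e f ht ⟨w, h1, h2, h3.1, h3.2⟩)
  · exact Or.inr (main f e ht.symm' ⟨w, h1, by rw [union_comm]; exact h2, h3.2, h3.1⟩)

theorem embed {r K : ℕ} (hr : 3 ≤ r) {F H : RGraph r} (hql : QuasiLinear F)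
    (hne : F.verts.Nonempty) (hadm : AdmitsSeq F (headTailSeq r))
    {w : Fin K → H.verts → ℝ} (hw : IsP w) {δ c t : ℝ} (hδ : 0 ≤ δ) (hc0 : 0 < c) (hc1 : c ≤ 1)
    (hreg : ∀ T1 T2 A : Finset (Fin K), RegProp w (fun x => eInd H T1 x * eInd H T2 x) A δ)
    (U : Finset (Fin K)) (hU : U.card = F.verts.card)
    (hgood : ∀ T1 T2, T1 ⊆ U → T2 ⊆ U → Spl r T1 T2 → c ≤ Ex w (fun x => eInd H T1 x * eInd H T2 x))
    (hδc : 6 * δ * F.edges.card < c ^ F.edges.card) (ht : ∀ i a, w i a ≤ t)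
    (ht0 : 0 ≤ t) (htc : 2 * ((K : ℝ) ^ 2 * t) < c ^ F.edges.card) :
    IsSubgraph F H := by
  classical
  obtain ⟨ord, hord, hdesc⟩ := hadm
  obtain ⟨j, hjU, hj⟩ := exists_place ord F.verts U hU hne
  have hinj : Set.InjOn j F.verts := by
    intro u hu v hv huv
    by_contra hne
    have h1 : ord u ≠ ord v := fun h => hne (hord hu hv h)
    rcases lt_or_gt_of_ne h1 with h2 | h2
    · exact absurd huv (hj u hu v hv h2).ne
    · exact absurd huv (hj v hv u hu h2).ne'
  have htw : ∀ e ∈ F.edges, ∃ f, IsTwin F e f := by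
    intro e he
    obtain ⟨f, hf, h1, h2, -⟩ := hql e he
    exact ⟨f, he, hf, h1.symm, h2⟩
  choose! tw htw using htw
  have tw_tw : ∀ e ∈ F.edges, tw (tw e) = e := by
    intro e he
    by_contra hne
    have h1 := htw e he
    have h2 := htw _ h1.2.1
    have := twin_others hql h1.symm' h2.2.1 h2.2.2.1.symm hne
    rw [h2.2.2.2] at this
    omega
  set s := F.edges.filter (fun e => Spl r (e.image j) ((tw e).image j)) with hs
  have hcov : ∀ e ∈ F.edges, e ∈ s ∨ tw e ∈ s := by
    intro e he
    rcases describes_spl hr (htw e he) (hdesc _ _ (htw e he)) hj hinj with h | h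
    · exact Or.inl (mem_filter.2 ⟨he, h⟩)
    · refine Or.inr (mem_filter.2 ⟨(htw e he).2.1, ?_⟩)
      rwa [tw_tw e he]
  have hanti : ∀ e ∈ s, tw e ∉ s := by
    intro e he h
    rw [hs, mem_filter] at he h
    rw [tw_tw e he.1] at h
    exact he.2.asymm hr h.2
  have hsE : ∀ e ∈ s, e ∈ F.edges := fun e he => (mem_filter.1 he).1
  have himU : ∀ e ∈ F.edges, e.image j ⊆ U := by
    intro e he i hi
    obtain ⟨v, hv, rfl⟩ := mem_image.1 hi
    exact hjU v (F.edges_subset e he hv)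
  have hcard : ∀ e ∈ F.edges, ∀ f ∈ F.edges, f ≠ e → f ≠ tw e → (e.image j ∩ f.image j).card ≤ 1 := by
    intro e he f hf h1 h2
    have hev := F.edges_subset e he
    have hfv := F.edges_subset f hf
    rw [← image_inter_of_injOn e f (hinj.mono (by simpa using ⟨hev, hfv⟩))]
    exact card_image_le.trans (twin_others hql (htw e he) hf h1 h2)
  have hcount := pairs_count hw (fun e b => (if b then tw e else e).image j)
    (fun e b => eInd H ((if b then tw e else e).image j)) (fun e b x => eInd_01 _ _ _)
    (fun e b => eInd_dep _ _) hc0.le hc1 hδ s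
    (by
      intro e he b
      have := hreg ((if b then tw e else e).image j) ((if b then tw e else e).image j)
      simp only [eInd_sq] at this
      exact this _)
    (fun e he => hreg _ _ _)
    (fun e he => hgood _ _ (himU _ (hsE e he)) (himU _ (htw _ (hsE e he)).2.1) (mem_filter.1 he).2)
    (by
      intro e he f hf hne b b'
      have heE := hsE e he
      have hfE := hsE f hf
      have htf : f ≠ tw e := fun h => hanti e he (h ▸ hf)
      have htf' : tw f ≠ e := fun h => hanti f hf (h ▸ he)
      have htff : tw f ≠ tw e := fun h => hne (by rw [← tw_tw e heE, ← h, tw_tw f hfE])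
      cases b <;> cases b'
      · exact hcard e heE f hfE hne.symm htf
      · exact hcard e heE _ (htw f hfE).2.1 htf' htff
      · exact hcard _ (htw e heE).2.1 f hfE htf (by rw [tw_tw e heE]; exact hne.symm)
      · exact hcard _ (htw e heE).2.1 _ (htw f hfE).2.1 htff (by rw [tw_tw e heE]; exact htf'))
  have hnon := Ex_noninj hw ht0 ht
  rw [Fintype.card_fin] at hnon
  have hscard : s.card ≤ F.edges.card := card_le_card (filter_subset _ _)
  have hpow : c ^ F.edges.card ≤ c ^ s.card := pow_le_pow_of_le_one hc0.le hc1 hscard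
  have h6 : 6 * δ * s.card ≤ 6 * δ * F.edges.card :=
    mul_le_mul_of_nonneg_left (by exact_mod_cast hscard) (by linarith)
  have hlt : Ex w (fun x => if Function.Injective x then (0:ℝ) else 1)
      < Ex w (fun x => ∏ e ∈ s, (eInd H ((if false then tw e else e).image j) x
        * eInd H ((if true then tw e else e).image j) x)) := by
    refine lt_of_lt_of_le ?_ hcount
    linarith
  obtain ⟨x, hx⟩ : ∃ x, (if Function.Injective x then (0:ℝ) else 1)
      < ∏ e ∈ s, (eInd H ((if false then tw e else e).image j) x
        * eInd H ((if true then tw e else e).image j) x) := by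
    by_contra hcon
    push Not at hcon
    exact absurd (Ex_mono hw hcon) (not_le.2 hlt)
  have hxinj : Function.Injective x := by
    by_contra h
    rw [if_neg h] at hx
    refine absurd hx (not_lt.2 (prod_le_one (fun e _ => ?_) fun e _ => ?_))
    · exact mul_nonneg (eInd_01 _ _ _).1 (eInd_01 _ _ _).1
    · exact mul_le_one₀ (eInd_01 _ _ _).2 (eInd_01 _ _ _).1 (eInd_01 _ _ _).2
  rw [if_pos hxinj] at hx
  have hboth : ∀ e ∈ s, (e.image j).image (fun i => (x i : ℕ)) ∈ H.edges
      ∧ ((tw e).image j).image (fun i => (x i : ℕ)) ∈ H.edges := by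
    intro e he
    have h1 := (prod_ne_zero_iff.1 hx.ne') e he
    simp only [eInd, if_true, Bool.false_eq_true, if_false] at h1
    constructor
    · by_contra h; simp [h] at h1
    · by_contra h; simp [h] at h1
  refine ⟨fun v => (x (j v) : ℕ), ?_, fun v _ => (x (j v)).2, ?_⟩
  · intro u hu v hv huv
    exact hinj hu hv (hxinj (Subtype.ext huv))
  · intro e he
    have h2 : e.image (fun v => (x (j v) : ℕ)) = (e.image j).image (fun i => (x i : ℕ)) := by
      rw [image_image]; rfl
    rw [h2]
    rcases hcov e he with h | h
    · exact (hboth e h).1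
    · have := (hboth _ h).2
      rwa [tw_tw e he] at this

end Embed
end UTD

namespace UTD
open Finset

section Weighted
variable {V : Type*} [Fintype V] [DecidableEq V]

theorem card_image_eq (r : ℕ) (e : Finset V) (he : e.card = r) :
    ((univ : Finset (Fin r → V)).filter (fun x => univ.image x = e)).card = r.factorial := by
  have h1 : Fintype.card (Fin r ↪ e) = r.factorial := by
    rw [Fintype.card_embedding_eq]
    simp [he, Nat.descFactorial_self]
  rw [← h1, ← card_univ]
  symm
  refine card_bij (fun g _ i => (g i : V)) ?_ ?_ ?_
  · intro g _
    simp only [mem_filter, mem_univ, true_and]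
    apply eq_of_subset_of_card_le
    · intro v hv
      obtain ⟨i, -, rfl⟩ := mem_image.1 hv
      exact (g i).2
    · rw [card_image_of_injective _ (fun a b h => g.injective (Subtype.ext h)), he]
      simp
  · intro g _ g' _ h
    ext i
    exact congrFun h i
  · intro x hx
    simp only [mem_filter, mem_univ, true_and] at hx
    have hinj : Function.Injective x := by
      rw [← Set.injOn_univ, ← coe_univ, ← card_image_iff, hx, he]
      simp
    refine ⟨⟨fun i => ⟨x i, by rw [← hx]; exact mem_image_of_mem _ (mem_univ i)⟩, fun a b h => ?_⟩,
      mem_univ _, rfl⟩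
    exact hinj (congrArg Subtype.val h)

theorem Ex_image (r : ℕ) (q : V → ℝ) (G : Finset (Finset V)) (hG : ∀ e ∈ G, e.card = r) :
    Ex (fun _ : Fin r => q) (fun x => if univ.image x ∈ G then (1:ℝ) else 0)
      = r.factorial * ∑ e ∈ G, ∏ v ∈ e, q v := by
  unfold Ex
  have h1 : ∀ x : Fin r → V, (∏ i, q (x i)) * (if univ.image x ∈ G then (1:ℝ) else 0)
      = ∑ e ∈ G, if univ.image x = e then ∏ v ∈ e, q v else 0 := by
    intro x
    rw [sum_ite_eq]
    split_ifs with h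
    · have hc := hG _ h
      have hinj : Function.Injective x := by
        rw [← Set.injOn_univ, ← coe_univ, ← card_image_iff, hc]
        simp
      rw [mul_one, prod_image (fun a _ b _ h => hinj h)]
    · simp
  simp only [h1]
  rw [sum_comm, mul_sum]
  refine sum_congr rfl fun e he => ?_
  rw [← sum_filter, sum_const, card_image_eq r e (hG e he), nsmul_eq_mul]

theorem weighted_density (r : ℕ) (E : Finset (Finset V)) (hE : ∀ e ∈ E, e.card = r) {d s0 t : ℝ}
    (hd0 : 0 ≤ d) (hd1 : d ≤ 1) (hs0 : 0 ≤ s0) (ht : 0 < t)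
    (hdense : ∀ S : Finset V, s0 ≤ S.card →
      d * (S.card.choose r : ℝ) ≤ ((E.filter (fun e => e ⊆ S)).card : ℝ))
    (q : V → ℝ) (hq0 : ∀ v, 0 ≤ q v) (hq1 : ∑ v, q v = 1) (hqt : ∀ v, q v ≤ t) :
    d * (1 - r ^ 2 * t) - r.factorial * (s0 * t) ^ r
      ≤ Ex (fun _ : Fin r => q) (fun x => if univ.image x ∈ E then (1:ℝ) else 0) := by
  set P := powersetCard r (univ : Finset V) with hP
  set b : V → Bool → ℝ := fun v c => if c then q v / t else 1 - q v / t with hb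
  have hbP : IsP b := by
    intro v
    have h1 : 0 ≤ q v / t := div_nonneg (hq0 v) ht.le
    have h2 : q v / t ≤ 1 := by rw [div_le_one ht]; exact hqt v
    refine ⟨fun c => ?_, ?_⟩
    · cases c <;> simp [hb] <;> linarith
    · simp [hb]
  have hEb : ∀ e : Finset V, e.card = r →
      Ex b (fun y => if e ⊆ univ.filter (fun v => y v = true) then (1:ℝ) else 0)
        = (∏ v ∈ e, q v) / t ^ r := by
    intro e he
    have h1 : ∀ y : V → Bool, (if e ⊆ univ.filter (fun v => y v = true) then (1:ℝ) else 0)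
        = ∏ v ∈ e, (fun _ c => if c = true then (1:ℝ) else 0) v (y v) := by
      intro y
      dsimp only
      rw [prod_ite_zero]
      simp [subset_iff]
    simp only [h1]
    rw [Ex_prod_coord hbP e (fun _ c => if c = true then (1:ℝ) else 0)]
    have h2 : ∀ v, Ex b (fun x => (if x v = true then (1:ℝ) else 0)) = q v / t := by
      intro v
      rw [Ex_coord hbP v (fun c => if c = true then (1:ℝ) else 0)]
      simp [hb]
    simp only [h2]
    rw [prod_div_distrib, prod_const, he]
  have hpt : ∀ y : V → Bool,
      d * (∑ e ∈ P, if e ⊆ univ.filter (fun v => y v = true) then (1:ℝ) else 0) - s0 ^ r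
      ≤ ∑ e ∈ E, if e ⊆ univ.filter (fun v => y v = true) then (1:ℝ) else 0 := by
    intro y
    set S := univ.filter (fun v => y v = true) with hS
    have h1 : (∑ e ∈ P, if e ⊆ S then (1:ℝ) else 0) = (S.card.choose r : ℝ) := by
      rw [sum_boole]
      congr 1
      rw [← card_powersetCard]
      congr 1
      ext e
      simp only [hP, mem_filter, mem_powersetCard]
      constructor
      · exact fun h => ⟨h.2, h.1.2⟩
      · exact fun h => ⟨⟨subset_univ _, h.2⟩, h.1⟩
    rw [h1, sum_boole]
    by_cases hc : s0 ≤ S.card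
    · have := hdense S hc
      have h2 : 0 ≤ s0 ^ r := by positivity
      linarith
    · push Not at hc
      have h2 : (S.card.choose r : ℝ) ≤ s0 ^ r := by
        calc (S.card.choose r : ℝ) ≤ (S.card : ℝ) ^ r := by exact_mod_cast Nat.choose_le_pow _ _
          _ ≤ s0 ^ r := by gcongr
      have h3 : d * (S.card.choose r : ℝ) ≤ S.card.choose r := mul_le_of_le_one_left (by positivity) hd1
      have h4 : (0:ℝ) ≤ ((E.filter (fun e => e ⊆ S)).card : ℝ) := by positivity
      linarith
  have hav := Ex_mono hbP hpt
  rw [Ex_sub, Ex_const hbP, Ex_mul_left, Ex_sum, Ex_sum] at hav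
  have e1 : ∑ e ∈ P, Ex b (fun y => if e ⊆ univ.filter (fun v => y v = true) then (1:ℝ) else 0)
      = (∑ e ∈ P, ∏ v ∈ e, q v) / t ^ r := by
    rw [sum_div]
    exact sum_congr rfl fun e he => hEb e (mem_powersetCard.1 he).2
  have e2 : ∑ e ∈ E, Ex b (fun y => if e ⊆ univ.filter (fun v => y v = true) then (1:ℝ) else 0)
      = (∑ e ∈ E, ∏ v ∈ e, q v) / t ^ r := by
    rw [sum_div]
    exact sum_congr rfl fun e he => hEb e (hE e he)
  rw [e1, e2] at hav
  have htr : 0 < t ^ r := by positivity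
  have hav2 : d * (∑ e ∈ P, ∏ v ∈ e, q v) - (s0 * t) ^ r ≤ ∑ e ∈ E, ∏ v ∈ e, q v := by
    have := mul_le_mul_of_nonneg_right hav htr.le
    rw [sub_mul, mul_assoc, div_mul_cancel₀ _ htr.ne', div_mul_cancel₀ _ htr.ne', ← mul_pow] at this
    exact this
  have hqP : IsP (fun _ : Fin r => q) := fun _ => ⟨hq0, hq1⟩
  have hnon := Ex_noninj hqP ht.le (fun _ => hqt)
  rw [Fintype.card_fin] at hnon
  have hPi : ∀ x : Fin r → V, (if univ.image x ∈ P then (1:ℝ) else 0)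
      = 1 - (if Function.Injective x then 0 else 1) := by
    intro x
    have : univ.image x ∈ P ↔ Function.Injective x := by
      rw [hP, mem_powersetCard, ← Set.injOn_univ, ← coe_univ, ← card_image_iff]
      simp
    simp only [this]
    split_ifs <;> norm_num
  have e3 := Ex_image r q P (fun e he => (mem_powersetCard.1 he).2)
  simp only [hPi] at e3
  rw [Ex_sub, Ex_const hqP] at e3
  rw [Ex_image r q E hE]
  have hf : (0:ℝ) < r.factorial := by exact_mod_cast Nat.factorial_pos r
  have h5 := mul_le_mul_of_nonneg_left hav2 hf.le
  have h6 : d * (1 - r ^ 2 * t) ≤ d * (r.factorial * ∑ e ∈ P, ∏ v ∈ e, q v) :=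
    mul_le_mul_of_nonneg_left (by linarith) hd0
  nlinarith

theorem Ex_prod_coord_inj {κ ι α : Type*} [Fintype ι] [DecidableEq ι] [Fintype α] [DecidableEq κ]
    {w : ι → α → ℝ} (hw : IsP w)
    {t : κ → ι} (ht : Function.Injective t) (B : Finset κ) (u : κ → α → ℝ) :
    Ex w (fun x => ∏ k ∈ B, u k (x (t k))) = ∏ k ∈ B, Ex w (fun x => u k (x (t k))) := by
  induction B using Finset.induction_on with
  | empty => simp [Ex_const hw]
  | insert k s hk ih =>
    simp only [prod_insert hk]
    rw [Ex_mul_indep hw (D := {t k}) (D' := s.image t) _ _ _, ih]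
    · intro x y h
      show u k _ = u k _
      rw [h (t k) (mem_singleton_self _)]
    · intro x y h
      exact prod_congr rfl fun l hl => by rw [h (t l) (mem_image_of_mem _ hl)]
    · rw [disjoint_singleton_left, mem_image]
      rintro ⟨l, hl, h⟩
      exact hk (ht h ▸ hl)

theorem Ex_marginal {κ ι α : Type*} [Fintype ι] [DecidableEq ι] [Fintype κ] [DecidableEq κ]
    [Fintype α] [DecidableEq α] {w : ι → α → ℝ} (hw : IsP w)
    {t : κ → ι} (ht : Function.Injective t) (G : (κ → α) → ℝ) :
    Ex w (fun x => G (fun k => x (t k))) = Ex (fun k => w (t k)) G := by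
  have hG : ∀ z : κ → α, G z = ∑ y, G y * ∏ k, (if z k = y k then (1:ℝ) else 0) := by
    intro z
    rw [Fintype.sum_eq_single z]
    · simp
    · intro y hy
      have : ∃ k, z k ≠ y k := by
        by_contra h; push Not at h; exact hy (funext fun k => (h k).symm)
      obtain ⟨k, hk⟩ := this
      rw [prod_eq_zero (mem_univ k) (by simp [hk]), mul_zero]
  have h1 : Ex w (fun x => G (fun k => x (t k))) = ∑ y, G y * ∏ k, w (t k) (y k) := by
    have : (fun x : ι → α => G (fun k => x (t k))) = fun x => ∑ y, G y * ∏ k, (if x (t k) = y k then (1:ℝ) else 0) := by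
      funext x; exact hG _
    rw [this, Ex_sum]
    refine sum_congr rfl fun y _ => ?_
    rw [Ex_mul_left, Ex_prod_coord_inj hw ht univ (fun k a => if a = y k then (1:ℝ) else 0)]
    congr 1
    refine prod_congr rfl fun k _ => ?_
    rw [Ex_coord hw (t k) (fun a => if a = y k then (1:ℝ) else 0)]
    simp
  rw [h1]
  unfold Ex
  exact sum_congr rfl fun y _ => mul_comm _ _

theorem low_bound {r K : ℕ} {H : RGraph r} {w : Fin K → H.verts → ℝ} (hw : IsP w) {t d ε ρ : ℝ}
    (ht0 : 0 < t) (ht : ∀ i a, w i a ≤ t) (hε : 0 ≤ ε) (hd0 : 0 ≤ d - ε) (hd1 : d - ε ≤ 1)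
    (hH : IsDense H d ε) (hρ : 0 ≤ ρ) (U : Finset (Fin K)) (hU : 0 < U.card)
    (hlow : ∀ T ⊆ U, T.card = r → Ex w (eInd H T) ≤ ρ) :
    (d - ε) * (1 - r ^ 2 * t) - r.factorial * (ε * H.verts.card * t) ^ r ≤ ρ + r ^ 2 / U.card := by
  classical
  set L : ℝ := ((U.card : ℕ) : ℝ) with hL
  have hLpos : 0 < L := by rw [hL]; exact_mod_cast hU
  set E : Finset (Finset H.verts) := (powersetCard r univ).filter
    (fun e => e.image Subtype.val ∈ H.edges) with hE
  set q : H.verts → ℝ := fun v => ∑ i : U, (1 / L) * w i v with hq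
  have hcardU : Fintype.card U = U.card := Fintype.card_coe U
  have hq0 : ∀ v, 0 ≤ q v := fun v => sum_nonneg fun i _ => mul_nonneg (by positivity) ((hw i).1 v)
  have hq1 : ∑ v, q v = 1 := by
    rw [hq, sum_comm]
    simp only [← mul_sum, (hw _).2]
    rw [sum_const, card_univ, hcardU, nsmul_eq_mul, ← hL]
    field_simp
  have hqt : ∀ v, q v ≤ t := by
    intro v
    calc q v ≤ ∑ i : U, (1 / L) * t := sum_le_sum fun i _ => mul_le_mul_of_nonneg_left (ht i v) (by positivity)
      _ = t := by
        rw [sum_const, card_univ, hcardU, nsmul_eq_mul, ← hL]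
        field_simp
  have hwd := weighted_density r E (fun e he => (mem_powersetCard.1 (mem_filter.1 he).1).2)
    hd0 hd1 (s0 := ε * H.verts.card) (by positivity) ht0 (by
      intro S hS
      have h1 := hH (S.image Subtype.val) (by
        intro v hv
        obtain ⟨u, -, rfl⟩ := mem_image.1 hv
        exact u.2)
      rw [card_image_of_injective _ Subtype.val_injective] at h1
      refine (h1 hS).trans ?_
      have : (H.edges.filter (fun e => e ⊆ S.image Subtype.val)).card
          ≤ (E.filter (fun e => e ⊆ S)).card := by
        refine card_le_card_of_surjOn (fun e : Finset H.verts => e.image Subtype.val) ?_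
        intro e he
        simp only [coe_filter, Set.mem_setOf_eq] at he
        obtain ⟨e', he', rfl⟩ := subset_image_iff.1 he.2
        refine ⟨e', ?_, rfl⟩
        simp only [coe_filter, Set.mem_setOf_eq, hE, mem_filter, mem_powersetCard]
        refine ⟨⟨⟨subset_univ _, ?_⟩, he.1⟩, ?_⟩
        · have := H.edges_card _ he.1
          rwa [card_image_of_injective _ Subtype.val_injective] at this
        · exact_mod_cast he'
      exact_mod_cast this) q hq0 hq1 hqt
  refine hwd.trans ?_
  set G : (Fin r → H.verts) → ℝ := fun x => if univ.image x ∈ E then (1:ℝ) else 0 with hG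
  have hexp : Ex (fun _ : Fin r => q) G
      = Ex (fun (_ : Fin r) (_ : U) => 1 / L) (fun τ => Ex (fun k => w (τ k)) G) := by
    unfold Ex
    simp only [hq]
    simp only [Fintype.prod_sum, mul_sum, sum_mul]
    rw [sum_comm]
    refine sum_congr rfl fun τ _ => sum_congr rfl fun x _ => ?_
    rw [prod_mul_distrib]
    ring
  have hu : IsP (fun (_ : Fin r) (_ : U) => 1 / L) := by
    intro _
    refine ⟨fun _ => by positivity, ?_⟩
    rw [sum_const, card_univ, hcardU, nsmul_eq_mul, ← hL]
    field_simp
  have hnon := Ex_noninj hu (t := 1 / L) (by positivity) (fun _ _ => le_rfl)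
  rw [Fintype.card_fin] at hnon
  rw [hexp]
  have hpt : ∀ τ : Fin r → U, Ex (fun k => w (τ k)) G ≤ ρ + (if Function.Injective τ then 0 else 1) := by
    intro τ
    have hwτ : IsP (fun k => w (τ k)) := fun k => hw (τ k)
    split_ifs with h
    · have hinj : Function.Injective (fun k => (τ k : Fin K)) := Subtype.val_injective.comp h
      rw [← Ex_marginal hw hinj G, add_zero]
      refine le_trans (Ex_mono hw fun x => ?_) (hlow (univ.image (fun k => (τ k : Fin K))) ?_ ?_)
      · simp only [hG, eInd]
        rw [image_image]
        by_cases hm : univ.image (fun k => x (τ k)) ∈ E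
        · have hm' := (mem_filter.1 hm).2
          rw [image_image] at hm'
          rw [if_pos hm, if_pos]
          exact hm'
        · rw [if_neg hm]
          split_ifs <;> norm_num
      · intro i hi
        obtain ⟨k, -, rfl⟩ := mem_image.1 hi
        exact (τ k).2
      · rw [card_image_of_injective _ hinj]; simp
    · refine (Ex_le hwτ (c := 1) fun x => ?_).trans (by linarith)
      simp only [hG]
      split_ifs <;> norm_num
  refine (Ex_mono hu hpt).trans ?_
  rw [Ex_add, Ex_const hu]
  have : (r : ℝ) ^ 2 * (1 / L) = r ^ 2 / L := by ring
  linarith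

end Weighted
end UTD

namespace UTD
open Finset

section Chain
variable {ι α : Type*} [Fintype ι] [DecidableEq ι] [Fintype α]

/-- indicator that the conditional average is large. -/
noncomputable def big (w : ι → α → ℝ) (f : (ι → α) → ℝ) (A : Finset ι) (δ : ℝ) (x : ι → α) : ℝ :=
  if δ < cav w f A x then 1 else 0

theorem big_01 (w : ι → α → ℝ) (f : (ι → α) → ℝ) (A : Finset ι) (δ : ℝ) (x : ι → α) :
    0 ≤ big w f A δ x ∧ big w f A δ x ≤ 1 := by
  unfold big; split_ifs <;> norm_num

theorem big_dep (w : ι → α → ℝ) (f : (ι → α) → ℝ) (A : Finset ι) (δ : ℝ) : Dep (big w f A δ) A := by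
  intro x y h
  unfold big
  rw [cav_dep w f A x y h]

theorem Ex_not_big {w : ι → α → ℝ} (hw : IsP w) {f : (ι → α) → ℝ} (A : Finset ι) {δ : ℝ} (hδ : 0 ≤ δ) :
    Ex w (fun x => f x * (1 - big w f A δ x)) ≤ δ := by
  rw [Ex_cav_one hw (Z := A)]
  · refine Ex_le hw fun x => ?_
    unfold big
    split_ifs with h
    · simpa using hδ
    · push Not at h
      simpa using h
  · intro x y h
    show 1 - big w f A δ x = 1 - big w f A δ y
    rw [big_dep w f A δ x y h]

theorem Ex_cav {w : ι → α → ℝ} (hw : IsP w) (f : (ι → α) → ℝ) (A : Finset ι) :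
    Ex w (cav w f A) = Ex w f := Ex_resample hw A f

theorem density_lemma {w : ι → α → ℝ} (hw : IsP w) {f : (ι → α) → ℝ} (hf01 : ∀ x, 0 ≤ f x ∧ f x ≤ 1)
    {A B : Finset ι} {i : ι} (hAB : A ∩ B ⊆ {i}) {ε δ κ : ℝ} (hε : 0 < ε) (hε1 : ε ≤ 1)
    (hδ0 : 0 ≤ δ) (hδ : δ ≤ ε ^ 2 / 200) (hκ : κ ≤ ε ^ 2 / 200)
    (hreg : RegProp w f ∅ κ) (hd : 1 / 4 + ε ≤ Ex w f) :
    1 + ε / 8 ≤ Ex w (big w f A δ) + Ex w (big w f B δ) := by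
  classical
  by_contra hcon
  push Not at hcon
  set σ := Ex w (big w f A δ) + Ex w (big w f B δ) with hσ
  set a := cav w (big w f A δ) {i} with ha
  set b := cav w (big w f B δ) {i} with hb
  have hσ0 : 0 ≤ σ := add_nonneg (Ex_nonneg hw fun x => (big_01 _ _ _ _ _).1)
    (Ex_nonneg hw fun x => (big_01 _ _ _ _ _).1)
  set η := ε / 8 with hη
  have hη0 : 0 < η := by positivity
  have ha0 : ∀ x, 0 ≤ a x := cav_nonneg hw (fun x => (big_01 _ _ _ _ _).1) {i}
  have hb0 : ∀ x, 0 ≤ b x := cav_nonneg hw (fun x => (big_01 _ _ _ _ _).1) {i}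
  have hEab : Ex w (fun x => a x + b x) = σ := by
    rw [Ex_add, hσ, ← Ex_cav hw (big w f A δ) {i}, ← Ex_cav hw (big w f B δ) {i}]
  set u : (ι → α) → ℝ := fun x => if a x + b x ≤ σ + η then 1 else 0 with hu
  have hu01 : ∀ x, 0 ≤ u x ∧ u x ≤ 1 := by
    intro x; simp only [hu]; split_ifs <;> norm_num
  have hudep : Dep u {i} := by
    intro x y h
    have h1 : a x = a y := cav_dep _ _ _ x y h
    have h2 : b x = b y := cav_dep _ _ _ x y h
    simp only [hu, h1, h2]
  -- `u` has large mean
  have hEu : η ≤ (σ + η) * Ex w u := by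
    have h1 : ∀ x, (σ + η) - (σ + η) * u x ≤ a x + b x := by
      intro x
      simp only [hu]
      have := ha0 x
      have := hb0 x
      split_ifs with h
      · linarith
      · push Not at h; linarith
    have h2 := Ex_mono hw h1
    rw [Ex_sub, Ex_const hw, Ex_mul_left, hEab] at h2
    linarith
  -- regularity
  have hr : Ex w u * Ex w f - κ ≤ Ex w (fun x => f x * u x) := by
    rcases isEmpty_or_nonempty α with hα | ⟨⟨a0⟩⟩
    · exfalso
      have := (hw i).2
      simp at this
    have hui : ∀ x, u x = (fun c => u (fun _ => c)) (x i) := by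
      intro x
      exact hudep _ _ (fun j hj => by rw [mem_singleton] at hj; subst hj; rfl)
    have := hreg {i} (by simp) (fun _ c => u (fun _ => c)) (fun _ c => hu01 _)
    simp only [prod_singleton, cav, Finset.piecewise_empty] at this
    rw [Ex_const hw] at this
    have h3 : Ex w (fun y => u (fun _ => y i)) = Ex w u := by
      congr 1; funext x; exact (hui x).symm
    have h4 : Ex w (fun y => f y * u (fun _ => y i)) = Ex w (fun x => f x * u x) := by
      congr 1; funext x; rw [hui x]
    rw [h3, h4] at this
    have := (abs_le.1 this).1
    linarith
  have hup : Ex w (fun x => f x * u x) ≤ ((σ + η) / 2) ^ 2 * Ex w u + 2 * δ := by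
    have h1 : ∀ x, f x * u x ≤ big w f A δ x * big w f B δ x * u x
        + (f x * (1 - big w f A δ x) + f x * (1 - big w f B δ x)) := by
      intro x
      have h2 := hf01 x
      have h3 := hu01 x
      unfold big
      split_ifs <;> nlinarith
    have h2 := Ex_mono hw h1
    rw [Ex_add, Ex_add] at h2
    have h3 := Ex_not_big (f := f) hw A hδ0
    have h4 := Ex_not_big (f := f) hw B hδ0
    have h5 : Ex w (fun x => big w f A δ x * big w f B δ x * u x) = Ex w (fun x => a x * b x * u x) :=
      Ex_cav_mul hw (Z := {i}) (X := A \ {i}) (Y := B \ {i})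
        ((big_dep w f A δ).mono (by intro j; simp; tauto))
        ((big_dep w f B δ).mono (by intro j; simp; tauto))
        (by
          rw [Finset.disjoint_left]
          intro j hj hj'
          rw [mem_sdiff] at hj hj'
          exact hj.2 (hAB (mem_inter.2 ⟨hj.1, hj'.1⟩)))
        (by simp) (by simp) hudep
    have h6 : Ex w (fun x => a x * b x * u x) ≤ Ex w (fun x => ((σ + η) / 2) ^ 2 * u x) := by
      refine Ex_mono hw fun x => ?_
      have := ha0 x
      have := hb0 x
      simp only [hu]
      split_ifs with h
      · rw [mul_one, mul_one]
        nlinarith [sq_nonneg (a x - b x)]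
      · simp
    rw [Ex_mul_left] at h6
    linarith
  have hEu0 : 0 ≤ Ex w u := Ex_nonneg hw fun x => (hu01 x).1
  have hm : Ex w u * (1 / 4 + ε) ≤ Ex w u * Ex w f := mul_le_mul_of_nonneg_left hd hEu0
  have hs : σ + η ≤ 1 + ε / 4 := by rw [hη]; linarith
  have hsq : ((σ + η) / 2) ^ 2 ≤ 1 / 4 + ε / 4 := by nlinarith
  have hs2 : (σ + η) * Ex w u ≤ 2 * Ex w u := mul_le_mul_of_nonneg_right (by linarith) hEu0
  have h7 : ((σ + η) / 2) ^ 2 * Ex w u ≤ (1 / 4 + ε / 4) * Ex w u := mul_le_mul_of_nonneg_right hsq hEu0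
  have h8 : ε / 16 ≤ Ex w u := by
    have h81 : η ≤ 2 * Ex w u := hEu.trans hs2
    rw [hη] at h81
    linarith
  have h9 : ε * Ex w u ≥ ε * (ε / 16) := mul_le_mul_of_nonneg_left h8 hε.le
  nlinarith

theorem bad_lemma {w : ι → α → ℝ} (hw : IsP w) {f g : (ι → α) → ℝ} (hf01 : ∀ x, 0 ≤ f x ∧ f x ≤ 1)
    (hg01 : ∀ x, 0 ≤ g x ∧ g x ≤ 1) {T T' : Finset ι} (hf : Dep f T) (hg : Dep g T') {δ c : ℝ}
    (hδ : 0 < δ) (hbad : Ex w (fun x => f x * g x) ≤ c) :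
    Ex w (big w f (T ∩ T') δ) + Ex w (big w g (T ∩ T') δ) ≤ 1 + c / δ ^ 2 := by
  have h1 := Ex_cav_mul hw (Z := T ∩ T') (X := T \ T') (Y := T' \ T) (f := f) (g := g)
    (hf.mono (by intro j; simp; tauto)) (hg.mono (by intro j; simp; tauto))
    (by rw [Finset.disjoint_left]; intro j; simp; tauto)
    (by rw [Finset.disjoint_left]; intro j; simp; tauto)
    (by rw [Finset.disjoint_left]; intro j; simp; tauto) (u := fun _ => 1) (fun _ _ _ => rfl)
  simp only [mul_one] at h1
  rw [h1] at hbad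
  rw [← Ex_add]
  have h2 : ∀ x, big w f (T ∩ T') δ x + big w g (T ∩ T') δ x
      ≤ 1 + (1 / δ ^ 2) * (cav w f (T ∩ T') x * cav w g (T ∩ T') x) := by
    intro x
    have ha := cav_nonneg hw (fun x => (hf01 x).1) (T ∩ T') x
    have hb := cav_nonneg hw (fun x => (hg01 x).1) (T ∩ T') x
    have hp : 0 ≤ (1 / δ ^ 2) * (cav w f (T ∩ T') x * cav w g (T ∩ T') x) := by positivity
    unfold big
    split_ifs with h h'
    · have : 1 ≤ (1 / δ ^ 2) * (cav w f (T ∩ T') x * cav w g (T ∩ T') x) := by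
        rw [div_mul_eq_mul_div, one_mul, le_div_iff₀ (by positivity)]
        nlinarith
      linarith
    all_goals linarith
  refine (Ex_mono hw h2).trans ?_
  rw [Ex_add, Ex_const hw, Ex_mul_left]
  have : 1 / δ ^ 2 * Ex w (fun x => cav w f (T ∩ T') x * cav w g (T ∩ T') x) ≤ 1 / δ ^ 2 * c :=
    mul_le_mul_of_nonneg_left hbad (by positivity)
  have h3 : 1 / δ ^ 2 * c = c / δ ^ 2 := by ring
  linarith

/-- the chain argument. -/
theorem chain_contra {r K : ℕ} (hr : 3 ≤ r) {H : RGraph r} {w : Fin K → H.verts → ℝ} (hw : IsP w)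
    {ε κ c δ : ℝ} (hε : 0 < ε) (hε1 : ε ≤ 1) (hδ : δ = ε ^ 2 / 200) (hκ : κ ≤ ε ^ 2 / 200)
    (hc : c ≤ ε / 16 * δ ^ 2)
    (hreg : ∀ T : Finset (Fin K), RegProp w (eInd H T) ∅ κ) (m : ℕ) (hm : 32 / ε < m)
    (U : Finset (Fin K)) (hU : U.card = m * (r - 2) + r)
    (hhigh : ∀ T ⊆ U, T.card = r → 1 / 4 + ε ≤ Ex w (eInd H T))
    (hbad : ∀ T1 T2, T1 ⊆ U → T2 ⊆ U → Spl r T1 T2 → Ex w (fun x => eInd H T1 x * eInd H T2 x) ≤ c) :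
    False := by
  classical
  have hδ0 : 0 < δ := by rw [hδ]; positivity
  -- the positions
  set o := U.orderEmbOfFin hU with ho
  set T : ℕ → Finset (Fin K) := fun s => ((univ : Finset (Fin (m * (r - 2) + r))).filter
    (fun i : Fin (m * (r - 2) + r) => s * (r - 2) ≤ (i : ℕ) ∧ (i : ℕ) < s * (r - 2) + r)).map o.toEmbedding with hT
  have hTU : ∀ s, T s ⊆ U := by
    intro s i hi
    obtain ⟨k, -, rfl⟩ := mem_map.1 hi
    exact orderEmbOfFin_mem U hU k
  have hcardI : ∀ a b : ℕ, b ≤ m * (r - 2) + r → a ≤ b →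
      ((univ : Finset (Fin (m * (r - 2) + r))).filter
        (fun i : Fin (m * (r - 2) + r) => a ≤ (i : ℕ) ∧ (i : ℕ) < b)).card = b - a := by
    intro a b hb hab
    rw [← Nat.card_Ico a b, ← card_map Fin.valEmbedding]
    congr 1
    ext k
    simp only [mem_map, mem_filter, mem_univ, true_and, Fin.valEmbedding_apply, mem_Ico]
    constructor
    · rintro ⟨i, hi, rfl⟩; exact hi
    · intro hk; exact ⟨⟨k, by omega⟩, hk, rfl⟩
  have hmul : ∀ s, s ≤ m → s * (r - 2) ≤ m * (r - 2) := fun s hs => Nat.mul_le_mul_right _ hs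
  have hTc : ∀ s ≤ m, (T s).card = r := by
    intro s hs
    have := hmul s hs
    rw [hT, card_map, hcardI _ _ (by omega) (by omega)]
    omega
  have hsucc : ∀ s, (s + 1) * (r - 2) = s * (r - 2) + (r - 2) := fun s => by ring
  have hinter : ∀ s, T s ∩ T (s + 1) = ((univ : Finset (Fin (m * (r - 2) + r))).filter
      (fun i : Fin (m * (r - 2) + r) => (s + 1) * (r - 2) ≤ (i : ℕ) ∧ (i : ℕ) < s * (r - 2) + r)).map o.toEmbedding := by
    intro s
    rw [hT, ← map_inter]
    congr 1
    ext i
    simp only [mem_inter, mem_filter, mem_univ, true_and]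
    rw [hsucc]
    omega
  have hspl : ∀ s, s + 1 ≤ m → Spl r (T s) (T (s + 1)) := by
    intro s hs
    have h1 := hmul (s + 1) hs
    have h2 := hsucc s
    refine ⟨hTc s (by omega), hTc _ hs, ?_, ?_, ?_⟩
    · rw [hinter, card_map, hcardI _ _ (by omega) (by omega)]
      omega
    · intro a ha b hb hb'
      obtain ⟨k, hk, rfl⟩ := mem_map.1 ha
      obtain ⟨l, hl, rfl⟩ := mem_map.1 hb
      rw [hT, mem_map'] at hb'
      simp only [mem_filter, mem_univ, true_and] at hk hl hb'
      show o k < o l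
      rw [OrderEmbedding.lt_iff_lt, Fin.lt_def]
      omega
    · intro b hb a ha ha'
      obtain ⟨k, hk, rfl⟩ := mem_map.1 ha
      obtain ⟨l, hl, rfl⟩ := mem_map.1 hb
      rw [hT, mem_map'] at ha'
      simp only [mem_filter, mem_univ, true_and] at hk hl ha'
      show o k < o l
      rw [OrderEmbedding.lt_iff_lt, Fin.lt_def]
      omega
  have hdens : ∀ s, s + 2 ≤ m → 1 + ε / 8 ≤
      Ex w (big w (eInd H (T (s + 1))) (T (s + 1) ∩ T (s + 2)) δ)
      + Ex w (big w (eInd H (T (s + 1))) (T s ∩ T (s + 1)) δ) := by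
    intro s hs
    have h1 := hmul (s + 2) hs
    have h2 := hsucc s
    have h3 := hsucc (s + 1)
    refine density_lemma hw (fun x => eInd_01 _ _ _) (i := o ⟨(s + 2) * (r - 2), ?_⟩) ?_ hε hε1 hδ0.le hδ.le hκ
      (hreg _) (hhigh _ (hTU _) (hTc _ (by omega)))
    · omega
    · intro x hx
      rw [mem_inter, hinter (s + 1), hinter s] at hx
      obtain ⟨hx1, hx2⟩ := hx
      obtain ⟨k, hk, rfl⟩ := mem_map.1 hx1
      rw [mem_map'] at hx2
      simp only [mem_filter, mem_univ, true_and] at hk hx2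
      rw [mem_singleton]
      show o k = o _
      congr 1
      apply Fin.ext
      simp only
      have h4 : s + 1 + 1 = s + 2 := rfl
      rw [h4] at hk h3
      omega
  have hbd : ∀ s, s + 1 ≤ m → Ex w (big w (eInd H (T s)) (T s ∩ T (s + 1)) δ)
      + Ex w (big w (eInd H (T (s + 1))) (T s ∩ T (s + 1)) δ) ≤ 1 + ε / 16 := by
    intro s hs
    refine (bad_lemma hw (fun x => eInd_01 _ _ _) (fun x => eInd_01 _ _ _) (eInd_dep _ _) (eInd_dep _ _) hδ0
      (hbad _ _ (hTU _) (hTU _) (hspl s hs))).trans ?_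
    have : c / δ ^ 2 ≤ ε / 16 := by rw [div_le_iff₀ (by positivity)]; exact hc
    linarith
  have hstep : ∀ s, s + 1 ≤ m → s * (ε / 16) ≤ Ex w (big w (eInd H (T s)) (T s ∩ T (s + 1)) δ) := by
    intro s
    induction s with
    | zero =>
      intro _
      simp only [Nat.cast_zero, zero_mul]
      exact Ex_nonneg hw fun x => (big_01 _ _ _ _ _).1
    | succ s ih =>
      intro hs
      have h1 := ih (by omega)
      have h2 := hdens s hs
      have h3 := hbd s (by omega)
      push_cast
      show _ ≤ Ex w (big w (eInd H (T (s + 1))) (T (s + 1) ∩ T (s + 2)) δ)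
      linarith
  have hmpos : 0 < m := by
    have : (0:ℝ) < m := lt_trans (by positivity) hm
    exact_mod_cast this
  obtain ⟨s, rfl⟩ : ∃ s, m = s + 1 := ⟨m - 1, by omega⟩
  have h1 := hstep s le_rfl
  have h2 : Ex w (big w (eInd H (T s)) (T s ∩ T (s + 1)) δ) ≤ 1 := Ex_le hw fun x => (big_01 _ _ _ _ _).2
  rw [div_lt_iff₀ hε] at hm
  push_cast at hm
  nlinarith

end Chain
end UTD

namespace UTD
open Finset
section Upper

theorem upper_small {r : ℕ} (hr : 3 ≤ r) {F : RGraph r} (hql : QuasiLinear F) (hne : F.verts.Nonempty)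
    (hadm : AdmitsSeq F (headTailSeq r)) {ε : ℝ} (hε : 0 < ε) (hε1 : ε ≤ 1 / 2) (H : ℕ → RGraph r)
    (hH : LocallyDense H (1 / 4 + ε)) : ∃ n, IsSubgraph F (H n) := by
  classical
  obtain ⟨e, he0, hetend, hcard, hdense⟩ := hH
  obtain ⟨ε1, hεdef⟩ : ∃ ε1 : ℝ, ε1 = ε / 2 := ⟨_, rfl⟩
  have hε10 : 0 < ε1 := by rw [hεdef]; positivity
  obtain ⟨δ, hδ⟩ : ∃ δ : ℝ, δ = ε1 ^ 2 / 200 := ⟨_, rfl⟩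
  have hδ0 : 0 < δ := by rw [hδ]; positivity
  obtain ⟨c, hc⟩ : ∃ c : ℝ, c = min (ε1 / 16 * δ ^ 2) 1 := ⟨_, rfl⟩
  have hc0 : 0 < c := by rw [hc]; exact lt_min (by positivity) one_pos
  have hc1 : c ≤ 1 := by rw [hc]; exact min_le_right _ _
  have hcl : c ≤ ε1 / 16 * δ ^ 2 := by rw [hc]; exact min_le_left _ _
  obtain ⟨q, hq⟩ : ∃ q : ℝ, q = c ^ F.edges.card := ⟨_, rfl⟩
  have hq0 : 0 < q := by rw [hq]; positivity
  obtain ⟨κ, hκ⟩ : ∃ κ : ℝ, κ = min (ε1 ^ 2 / 200) (q / (6 * F.edges.card + 1)) := ⟨_, rfl⟩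
  have hκ0 : 0 < κ := by rw [hκ]; exact lt_min (by positivity) (by positivity)
  have hκ1 : κ ≤ ε1 ^ 2 / 200 := by rw [hκ]; exact min_le_left _ _
  have hκ2 : 6 * κ * F.edges.card < c ^ F.edges.card := by
    rw [← hq]
    have h1 : κ ≤ q / (6 * F.edges.card + 1) := by rw [hκ]; exact min_le_right _ _
    rw [le_div_iff₀ (by positivity)] at h1
    nlinarith
  obtain ⟨m, hm⟩ := exists_nat_gt (32 / ε1)
  obtain ⟨K1, hK1⟩ := ramsey_aux (2 * r - 2) F.verts.card (m * (r - 2) + r)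
  obtain ⟨L1, hL1⟩ := exists_nat_gt (r ^ 2 / (ε / 8))
  have hL1r : (0:ℝ) < L1 := lt_of_le_of_lt (by positivity) hL1
  have hL1' : (r:ℝ) ^ 2 / L1 < ε / 8 := by
    rw [div_lt_iff₀ (by positivity)] at hL1
    rw [div_lt_iff₀ hL1r]
    linarith
  obtain ⟨K, hK⟩ := ramsey_aux r K1 L1
  obtain ⟨M, hM1, hM⟩ := exists_regular (Fin K) (Finset (Fin K) × Finset (Fin K) × Finset (Fin K)) κ hκ0
  have hM0 : 0 < M := by linarith
  -- choose the index
  have hcardR : Filter.Tendsto (fun n => ((H n).verts.card : ℝ)) Filter.atTop Filter.atTop :=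
    tendsto_natCast_atTop_atTop.comp hcard
  have htau : Filter.Tendsto (fun n => M / ((H n).verts.card : ℝ)) Filter.atTop (nhds 0) :=
    hcardR.const_div_atTop M
  have hphi : Filter.Tendsto (fun n => (1 / 4 + ε - e n) * (1 - (r:ℝ) ^ 2 * (M / ((H n).verts.card : ℝ)))
      - r.factorial * (e n * M) ^ r) Filter.atTop (nhds ((1 / 4 + ε - 0) * (1 - (r:ℝ) ^ 2 * 0)
      - r.factorial * (0 * M) ^ r)) := by
    refine Filter.Tendsto.sub (Filter.Tendsto.mul (tendsto_const_nhds.sub hetend)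
      (tendsto_const_nhds.sub (htau.const_mul _))) (Filter.Tendsto.const_mul _ ?_)
    exact (hetend.mul_const M).pow r
  have hpsi : Filter.Tendsto (fun n => 2 * ((K:ℝ) ^ 2 * (M / ((H n).verts.card : ℝ)))) Filter.atTop
      (nhds (2 * ((K:ℝ) ^ 2 * 0))) := (htau.const_mul _).const_mul _
  have hev1 := hphi.eventually_const_lt (u := 1 / 4 + ε / 2 + ε / 8) ((by
    rw [zero_mul, zero_pow (by omega)]; linarith))
  have hev2 := hpsi.eventually_lt_const (u := q) (by simpa using hq0)
  have hev3 := hetend.eventually_lt_const (u := 1 / 4) (by norm_num)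
  have hev4 := hcard.eventually (Filter.eventually_ge_atTop 1)
  obtain ⟨n, hn1, hn2, hn3, hn4⟩ := (hev1.and (hev2.and (hev3.and hev4))).exists
  refine ⟨n, ?_⟩
  have hN0 : (0:ℝ) < (H n).verts.card := by exact_mod_cast hn4
  obtain ⟨w, hw, hwM, hreg'⟩ := hM (H n).verts (fun k x => eInd (H n) k.1 x * eInd (H n) k.2.1 x)
    (fun k => k.2.2) (fun _ _ => 1 / ((H n).verts.card : ℝ))
    (fun i => ⟨fun a => by positivity, by
      rw [sum_const, card_univ, Fintype.card_coe, nsmul_eq_mul]; field_simp⟩)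
    (fun k x => ⟨mul_nonneg (eInd_01 _ _ _).1 (eInd_01 _ _ _).1,
      mul_le_one₀ (eInd_01 _ _ _).2 (eInd_01 _ _ _).1 (eInd_01 _ _ _).2⟩)
  have hreg : ∀ T1 T2 A : Finset (Fin K), RegProp w (fun x => eInd (H n) T1 x * eInd (H n) T2 x) A κ :=
    fun T1 T2 A => hreg' (T1, T2, A)
  have ht : ∀ i a, w i a ≤ M / ((H n).verts.card : ℝ) := by
    intro i a
    have := hwM i a
    rwa [mul_one_div] at this
  have ht0 : 0 < M / ((H n).verts.card : ℝ) := by positivity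
  rcases hK K univ (fun T => 1 / 4 + ε1 ≤ Ex w (eInd (H n) T)) (by simp) with
    ⟨S, -, hS, hhigh⟩ | ⟨S, -, hS, hlow⟩
  · rcases hK1 K S (fun Q => ∃ T1 T2, T1 ∪ T2 = Q ∧ Spl r T1 T2 ∧
        c ≤ Ex w (fun x => eInd (H n) T1 x * eInd (H n) T2 x)) hS.ge with
      ⟨U, hUS, hU, hgood⟩ | ⟨U, hUS, hU, hbad⟩
    · refine embed hr hql hne hadm hw hκ0.le hc0 hc1 hreg U hU ?_ hκ2 ht ht0.le (by rw [← hq]; exact hn2)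
      intro T1 T2 h1 h2 hs
      obtain ⟨S1, S2, hu, hs', hcc⟩ := hgood (T1 ∪ T2) (union_subset h1 h2) hs.card_union
      obtain ⟨rfl, rfl⟩ := hs.unique hs' hu.symm
      exact hcc
    · exfalso
      refine chain_contra hr hw hε10 (by rw [hεdef]; linarith) hδ hκ1 hcl (fun T => ?_) m hm U hU
        (fun T hT => hhigh T (hT.trans hUS)) ?_
      · have := hreg T T ∅
        simp only [eInd_sq] at this
        exact this
      · intro T1 T2 h1 h2 hs
        by_contra hcon
        exact hbad (T1 ∪ T2) (union_subset h1 h2) hs.card_union ⟨T1, T2, rfl, hs, (not_le.1 hcon).le⟩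
  · exfalso
    have := low_bound hw ht0 ht (he0 n).le (d := 1 / 4 + ε) (by linarith) (by linarith [he0 n]) (hdense n)
      (ρ := 1 / 4 + ε1) (by linarith) S (by rw [hS]; exact_mod_cast hL1r)
      (fun T hT hTr => (not_le.1 (hlow T hT hTr)).le)
    rw [hS, mul_assoc, mul_div_cancel₀ _ hN0.ne'] at this
    rw [hεdef] at this
    linarith

theorem upper {r : ℕ} (hr : 3 ≤ r) {F : RGraph r} (hql : QuasiLinear F) (hhtm : HeadTailMixing F)
    (hadm : AdmitsSeq F (headTailSeq r)) {ε : ℝ} (hε : 0 < ε) (H : ℕ → RGraph r)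
    (hH : LocallyDense H (1 / 4 + ε)) : ∃ n, IsSubgraph F (H n) := by
  have hne : F.verts.Nonempty := by
    obtain ⟨e, he, -⟩ := hhtm id (Set.injOn_id _)
    have h1 := F.edges_card e he
    have h2 : e.Nonempty := card_pos.1 (by omega)
    exact h2.mono (F.edges_subset e he)
  refine upper_small hr hql hne hadm (ε := min ε (1 / 2)) (lt_min hε (by norm_num)) (min_le_right _ _) H ?_
  obtain ⟨e, h1, h2, h3, h4⟩ := hH
  refine ⟨e, h1, h2, h3, fun n S hS hc => le_trans ?_ (h4 n S hS hc)⟩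
  refine mul_le_mul_of_nonneg_right ?_ (Nat.cast_nonneg _)
  linarith [min_le_left ε (1 / 2)]

end Upper
end UTD

namespace UTD
open Finset
section LowerSigns

/-- a sign from a Boolean. -/
def sgn (b : Bool) : ℝ := if b then 1 else -1

theorem sgn_sq (b : Bool) : sgn b * sgn b = 1 := by cases b <;> norm_num [sgn]
theorem sgn_not (b : Bool) : sgn (!b) = - sgn b := by cases b <;> norm_num [sgn]

theorem four_zero {n : ℕ} {a a' b b' : Fin n} (ha : a ≠ a') (hb : b ≠ b') :
    ∑ s : Fin n × Fin n → Bool, sgn (s (a, b)) * sgn (s (a', b)) * (sgn (s (a, b')) * sgn (s (a', b'))) = 0 := by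
  classical
  have hinv : Function.Involutive (fun s : Fin n × Fin n → Bool => Function.update s (a, b) (!s (a, b))) := by
    intro s
    simp
  obtain ⟨σ, hσ⟩ : ∃ σ : (Fin n × Fin n → Bool) ≃ (Fin n × Fin n → Bool),
      ∀ s, σ s = Function.update s (a, b) (!s (a, b)) :=
    ⟨Function.Involutive.toPerm _ hinv, fun s => rfl⟩
  have h := Equiv.sum_comp σ
    (fun s : Fin n × Fin n → Bool => sgn (s (a, b)) * sgn (s (a', b)) * (sgn (s (a, b')) * sgn (s (a', b'))))
  have h2 : ∀ s : Fin n × Fin n → Bool,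
      sgn (σ s (a, b)) * sgn (σ s (a', b)) * (sgn (σ s (a, b')) * sgn (σ s (a', b')))
      = - (sgn (s (a, b)) * sgn (s (a', b)) * (sgn (s (a, b')) * sgn (s (a', b')))) := by
    intro s
    have e1 : σ s (a, b) = !s (a, b) := by simp [hσ]
    have e2 : σ s (a', b) = s (a', b) := by
      simp [hσ, Function.update_apply, ha.symm]
    have e3 : σ s (a, b') = s (a, b') := by
      simp [hσ, Function.update_apply, hb.symm]
    have e4 : σ s (a', b') = s (a', b') := by
      simp [hσ, Function.update_apply, ha.symm]
    rw [e1, e2, e3, e4, sgn_not]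
    ring
  simp only [h2] at h
  rw [sum_neg_distrib] at h
  linarith

/-- truncated correlation of two rows. -/
def corr {n : ℕ} (g : Fin n → Fin n → ℝ) (a a' : Fin n) : ℝ :=
  ∑ b, if a < b ∧ a' < b then g a b * g a' b else 0

theorem sign_exists (n : ℕ) : ∃ g : Fin n → Fin n → ℝ, (∀ a b, g a b = 1 ∨ g a b = -1) ∧
    ∑ a, ∑ a', (if a = a' then 0 else corr g a a' ^ 2) ≤ (n:ℝ) ^ 3 := by
  classical
  have key : ∑ s : Fin n × Fin n → Bool,
      (∑ a, ∑ a', (if a = a' then 0 else corr (fun a b => sgn (s (a, b))) a a' ^ 2))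
      ≤ ∑ s : Fin n × Fin n → Bool, (n:ℝ) ^ 3 := by
    rw [sum_comm]
    have h1 : ∀ a a' : Fin n, ∑ s : Fin n × Fin n → Bool,
        (if a = a' then 0 else corr (fun a b => sgn (s (a, b))) a a' ^ 2)
        ≤ ∑ s : Fin n × Fin n → Bool, (n:ℝ) := by
      intro a a'
      by_cases haa : a = a'
      · simp only [haa, if_true]
        exact sum_le_sum fun _ _ => Nat.cast_nonneg _
      · simp only [haa, if_false, corr, sq, sum_mul_sum]
        rw [sum_comm]
        have h2 : ∀ b : Fin n, ∑ s : Fin n × Fin n → Bool, ∑ b',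
            (if a < b ∧ a' < b then sgn (s (a, b)) * sgn (s (a', b)) else 0) *
            (if a < b' ∧ a' < b' then sgn (s (a, b')) * sgn (s (a', b')) else 0)
            ≤ ∑ s : Fin n × Fin n → Bool, (1:ℝ) := by
          intro b
          rw [sum_comm, sum_eq_single b]
          · refine sum_le_sum fun s _ => ?_
            split_ifs
            · have h3 := sgn_sq (s (a, b))
              have h4 := sgn_sq (s (a', b))
              have : sgn (s (a, b)) * sgn (s (a', b)) * (sgn (s (a, b)) * sgn (s (a', b)))
                = (sgn (s (a, b)) * sgn (s (a, b))) * (sgn (s (a', b)) * sgn (s (a', b))) := by ring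
              rw [this, h3, h4]; norm_num
            · norm_num
          · intro b' _ hb'
            by_cases hc : (a < b ∧ a' < b) ∧ (a < b' ∧ a' < b')
            · simp only [hc.1, hc.2, and_self, if_true]
              exact four_zero haa hb'.symm
            · refine sum_eq_zero fun s _ => ?_
              by_cases h5 : a < b ∧ a' < b
              · rw [if_neg (fun h6 => hc ⟨h5, h6⟩), mul_zero]
              · rw [if_neg h5, zero_mul]
          · simp
        refine (sum_le_sum fun b _ => h2 b).trans ?_
        simp only [sum_const, nsmul_eq_mul, mul_one, card_univ, Fintype.card_fin]
        exact le_of_eq (mul_comm _ _)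
    have h2 : ∀ a : Fin n, ∑ s : Fin n × Fin n → Bool,
        ∑ a', (if a = a' then 0 else corr (fun a b => sgn (s (a, b))) a a' ^ 2)
        ≤ ∑ a' : Fin n, ∑ s : Fin n × Fin n → Bool, (n:ℝ) := by
      intro a
      rw [sum_comm]
      exact sum_le_sum fun a' _ => h1 a a'
    refine (sum_le_sum fun a _ => h2 a).trans ?_
    simp only [sum_const, nsmul_eq_mul, mul_one, card_univ, Fintype.card_fin]
    exact le_of_eq (by ring)
  obtain ⟨s, -, hs⟩ := exists_le_of_sum_le univ_nonempty key
  refine ⟨fun a b => sgn (s (a, b)), fun a b => ?_, hs⟩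
  show sgn (s (a, b)) = 1 ∨ sgn (s (a, b)) = -1
  cases s (a, b) <;> simp [sgn]

theorem disc {n : ℕ} {g : Fin n → Fin n → ℝ} (hg : ∀ a b, g a b = 1 ∨ g a b = -1)
    (hs : ∑ a, ∑ a', (if a = a' then 0 else corr g a a' ^ 2) ≤ (n:ℝ) ^ 3) {γ : ℝ} (hγ : 0 < γ)
    (h1 : 2 ≤ γ ^ 2 * n) (h2 : 4 ≤ γ ^ 4 * n) (w : Fin n → ℝ) (hw : ∀ a, |w a| ≤ 1) :
    ∑ b, |∑ a, if a < b then w a * g a b else 0| ≤ γ * (n:ℝ) ^ 2 := by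
  classical
  set f : Fin n → ℝ := fun b => ∑ a, if a < b then w a * g a b else 0 with hf
  have hn0 : (0:ℝ) ≤ n := Nat.cast_nonneg _
  have hcs : (∑ b, |f b|) ^ 2 ≤ n * ∑ b, f b ^ 2 := by
    have := sq_sum_le_card_mul_sum_sq (s := (univ : Finset (Fin n))) (f := fun b => |f b|)
    simpa using this
  have hgg : ∀ a b, g a b * g a b = 1 := by
    intro a b; rcases hg a b with h | h <;> rw [h] <;> norm_num
  have hexp : ∑ b, f b ^ 2 = ∑ a, ∑ a', w a * w a' * corr g a a' := by
    have hsq : ∀ b, f b ^ 2 = ∑ a, ∑ a', (if a < b then w a * g a b else 0) *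
        (if a' < b then w a' * g a' b else 0) := fun b => by rw [sq, hf, sum_mul_sum]
    simp only [hsq, corr, mul_sum]
    rw [sum_comm]
    refine sum_congr rfl fun a _ => ?_
    rw [sum_comm]
    refine sum_congr rfl fun a' _ => sum_congr rfl fun b _ => ?_
    by_cases ha : a < b <;> by_cases ha' : a' < b <;> simp [ha, ha']
    ring
  set off : ℝ := ∑ a, ∑ a', (if a = a' then 0 else |corr g a a'|) with hoff
  have hoff0 : 0 ≤ off := sum_nonneg fun a _ => sum_nonneg fun a' _ => by split_ifs <;> positivity
  have hcorr : ∀ a : Fin n, |corr g a a| ≤ n := by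
    intro a
    refine (abs_sum_le_sum_abs _ _).trans ?_
    have : ∀ b : Fin n, |if a < b ∧ a < b then g a b * g a b else 0| ≤ 1 := by
      intro b
      split_ifs
      · rw [hgg]; norm_num
      · norm_num
    refine (sum_le_sum fun b _ => this b).trans ?_
    simp
  have hle : ∑ b, f b ^ 2 ≤ (n:ℝ) ^ 2 + off := by
    rw [hexp]
    have h3 : ∀ a a' : Fin n, w a * w a' * corr g a a'
        ≤ (if a = a' then (n:ℝ) else 0) + (if a = a' then 0 else |corr g a a'|) := by
      intro a a'
      have h4 : w a * w a' * corr g a a' ≤ |corr g a a'| := by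
        refine (le_abs_self _).trans ?_
        rw [abs_mul, abs_mul]
        have : |w a| * |w a'| ≤ 1 := mul_le_one₀ (hw a) (abs_nonneg _) (hw a')
        nlinarith [abs_nonneg (corr g a a')]
      split_ifs with h
      · subst h; linarith [hcorr a]
      · linarith
    refine (sum_le_sum fun a _ => sum_le_sum fun a' _ => h3 a a').trans ?_
    simp only [sum_add_distrib]
    rw [← hoff]
    simp [sq]
  have hoff2 : off ^ 2 ≤ (n:ℝ) ^ 5 := by
    have h5 : off = ∑ p ∈ (univ : Finset (Fin n × Fin n)), (if p.1 = p.2 then 0 else |corr g p.1 p.2|) := by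
      rw [hoff, ← univ_product_univ, sum_product]
    rw [h5]
    refine (sq_sum_le_card_mul_sum_sq).trans ?_
    have h6 : ∑ p ∈ (univ : Finset (Fin n × Fin n)), (if p.1 = p.2 then 0 else |corr g p.1 p.2|) ^ 2
        ≤ (n:ℝ) ^ 3 := by
      rw [← univ_product_univ, sum_product]
      refine le_trans (le_of_eq ?_) hs
      refine sum_congr rfl fun a _ => sum_congr rfl fun a' _ => ?_
      split_ifs <;> simp
    have h7 : (((univ : Finset (Fin n × Fin n)).card : ℕ) : ℝ) = (n:ℝ) ^ 2 := by simp [sq]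
    rw [h7]
    calc (n:ℝ) ^ 2 * _ ≤ (n:ℝ) ^ 2 * (n:ℝ) ^ 3 := mul_le_mul_of_nonneg_left h6 (by positivity)
      _ = (n:ℝ) ^ 5 := by ring
  have h8 : off ≤ γ ^ 2 * (n:ℝ) ^ 3 / 2 := by
    refine abs_le_of_sq_le_sq' ?_ (by positivity) |>.2
    refine hoff2.trans ?_
    have : (n:ℝ) ^ 5 * 4 ≤ (n:ℝ) ^ 5 * (γ ^ 4 * n) := mul_le_mul_of_nonneg_left h2 (by positivity)
    nlinarith
  have h9 : (n:ℝ) ^ 2 ≤ γ ^ 2 * (n:ℝ) ^ 3 / 2 := by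
    have : (n:ℝ) ^ 2 * 2 ≤ (n:ℝ) ^ 2 * (γ ^ 2 * n) := mul_le_mul_of_nonneg_left h1 (by positivity)
    nlinarith
  refine abs_le_of_sq_le_sq' ?_ (by positivity) |>.2
  refine hcs.trans ?_
  have : (n:ℝ) * ∑ b, f b ^ 2 ≤ n * (γ ^ 2 * (n:ℝ) ^ 3) := mul_le_mul_of_nonneg_left (by linarith) hn0
  refine this.trans (le_of_eq (by ring))

end LowerSigns
end UTD

namespace UTD
open Finset
section LowerTuples

theorem sum_resample {r n : ℕ} (F : (Fin r → Fin n) → ℝ) (i : Fin r) :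
    (n:ℝ) * ∑ x, F x = ∑ x, ∑ a, F (Function.update x i a) := by
  classical
  have hinv : Function.Involutive (fun p : (Fin r → Fin n) × Fin n => (Function.update p.1 i p.2, p.1 i)) := by
    intro p
    simp
  have h := Equiv.sum_comp (Function.Involutive.toPerm _ hinv) (fun p : (Fin r → Fin n) × Fin n => F p.1)
  rw [← univ_product_univ, sum_product, sum_product] at h
  simp only [sum_const, card_univ, Fintype.card_fin, nsmul_eq_mul, ← mul_sum] at h
  rw [← h]
  rfl

theorem tuple_bound {r n : ℕ} (F : (Fin r → Fin n) → ℝ) (i j k : Fin r) (hkj : k ≠ j)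
    (Q : Fin n → Fin n → ℝ) (B : ℝ) (h1 : ∀ x, |∑ a, F (Function.update x i a)| ≤ Q (x k) (x j))
    (h2 : ∀ y, ∑ b, Q y b ≤ B) : (n:ℝ) ^ 2 * |∑ x, F x| ≤ (n:ℝ) ^ r * B := by
  classical
  have hn : (0:ℝ) ≤ n := Nat.cast_nonneg _
  have e1 : (n:ℝ) * |∑ x, F x| ≤ ∑ x : Fin r → Fin n, Q (x k) (x j) := by
    rw [← abs_of_nonneg hn, ← abs_mul, sum_resample F i]
    exact (abs_sum_le_sum_abs _ _).trans (sum_le_sum fun x _ => h1 x)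
  have e2 : (n:ℝ) * ∑ x : Fin r → Fin n, Q (x k) (x j) ≤ (n:ℝ) ^ r * B := by
    rw [sum_resample (fun x => Q (x k) (x j)) j]
    have : ∀ x : Fin r → Fin n, ∑ a, Q (Function.update x j a k) (Function.update x j a j) ≤ B := by
      intro x
      simp only [Function.update_self, Function.update_of_ne hkj]
      exact h2 _
    refine (sum_le_sum fun x _ => this x).trans ?_
    simp
  calc (n:ℝ) ^ 2 * |∑ x, F x| = n * (n * |∑ x, F x|) := by ring
    _ ≤ n * ∑ x : Fin r → Fin n, Q (x k) (x j) := mul_le_mul_of_nonneg_left e1 hn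
    _ ≤ _ := e2

/-- increasing tuples inside `S`. -/
def Inc {r n : ℕ} (S : Finset ℕ) (x : Fin r → Fin n) : Prop :=
  StrictMono x ∧ ∀ i, (x i : ℕ) ∈ S

open Classical in
theorem gen_bound {r n : ℕ} (hn : 0 < n) {g : Fin n → Fin n → ℝ} {γ : ℝ}
    (hd : ∀ w : Fin n → ℝ, (∀ a, |w a| ≤ 1) →
      ∑ b, |∑ a, if a < b then w a * g a b else 0| ≤ γ * (n:ℝ) ^ 2)
    (S : Finset ℕ) (i j k : Fin r) (hkj : k ≠ j) (hij : i ≠ j)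
    (W : Fin n → Fin n → Prop)
    (hR : ∀ x : Fin r → Fin n, ∃ R : Prop, ∀ a, Inc S (Function.update x i a) ↔
      R ∧ (a : ℕ) ∈ S ∧ W (x k) a ∧ a < x j)
    (h : (Fin r → Fin n) → ℝ) (hh : ∀ x, |h x| ≤ 1) (hi : ∀ x a, h (Function.update x i a) = h x) :
    |∑ x : Fin r → Fin n, if Inc S x then g (x i) (x j) * h x else 0| ≤ γ * (n:ℝ) ^ r := by
  have hn' : (0:ℝ) < n := by exact_mod_cast hn
  have := tuple_bound (fun x : Fin r → Fin n => if Inc S x then g (x i) (x j) * h x else 0) i j k hkj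
    (fun y b => |∑ a, if a < b then (if (a : ℕ) ∈ S ∧ W y a then 1 else 0) * g a b else 0|) (γ * (n:ℝ) ^ 2)
    ?_ ?_
  · have h2 : (n:ℝ) ^ r * (γ * (n:ℝ) ^ 2) = (n:ℝ) ^ 2 * (γ * (n:ℝ) ^ r) := by ring
    rw [h2] at this
    exact le_of_mul_le_mul_left this (by positivity)
  · intro x
    obtain ⟨R, hR⟩ := hR x
    by_cases hRR : R
    · have : ∀ a, (if Inc S (Function.update x i a) then
          g (Function.update x i a i) (Function.update x i a j) * h (Function.update x i a) else 0)
          = h x * (if a < x j then (if (a : ℕ) ∈ S ∧ W (x k) a then 1 else 0) * g a (x j) else 0) := by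
        intro a
        rw [hi, Function.update_self, Function.update_of_ne hij.symm]
        simp only [hR a, hRR, true_and]
        by_cases h1 : a < x j <;> by_cases h2 : (a : ℕ) ∈ S ∧ W (x k) a
        · rw [if_pos ⟨h2.1, h2.2, h1⟩, if_pos h1, if_pos h2]; ring
        · rw [if_neg (fun h3 => h2 ⟨h3.1, h3.2.1⟩), if_pos h1, if_neg h2]; ring
        · rw [if_neg (fun h3 => h1 h3.2.2), if_neg h1]; ring
        · rw [if_neg (fun h3 => h1 h3.2.2), if_neg h1]; ring
      simp only [this, ← mul_sum]
      rw [abs_mul]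
      exact mul_le_of_le_one_left (abs_nonneg _) (hh x)
    · have : ∀ a, (if Inc S (Function.update x i a) then
          g (Function.update x i a i) (Function.update x i a j) * h (Function.update x i a) else 0) = 0 := by
        intro a
        rw [if_neg]
        rw [hR a]
        exact fun h3 => hRR h3.1
      simp only [this, sum_const_zero, abs_zero]
      exact abs_nonneg _
  · intro y
    refine hd _ fun a => ?_
    split_ifs <;> norm_num

theorem Inc_update {r n : ℕ} (S : Finset ℕ) (x : Fin r → Fin n) (i : Fin r) (a : Fin n) :
    Inc S (Function.update x i a) ↔
      ((∀ j k, j < k → j ≠ i → k ≠ i → x j < x k) ∧ (∀ j, j ≠ i → (x j : ℕ) ∈ S)) ∧ (a : ℕ) ∈ S ∧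
      (∀ j, j < i → x j < a) ∧ (∀ j, i < j → a < x j) := by
  constructor
  · rintro ⟨h1, h2⟩
    refine ⟨⟨fun j k hjk hj hk => ?_, fun j hj => ?_⟩, ?_, fun j hj => ?_, fun j hj => ?_⟩
    · have := h1 hjk
      rwa [Function.update_of_ne hj, Function.update_of_ne hk] at this
    · have := h2 j
      rwa [Function.update_of_ne hj] at this
    · have := h2 i
      rwa [Function.update_self] at this
    · have := h1 hj
      rwa [Function.update_self, Function.update_of_ne hj.ne] at this
    · have := h1 hj
      rwa [Function.update_self, Function.update_of_ne hj.ne'] at this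
  · rintro ⟨⟨h1, h2⟩, h3, h4, h5⟩
    refine ⟨fun j k hjk => ?_, fun j => ?_⟩
    · by_cases hj : j = i
      · subst hj
        rw [Function.update_self, Function.update_of_ne hjk.ne']
        exact h5 k hjk
      · by_cases hk : k = i
        · subst hk
          rw [Function.update_self, Function.update_of_ne hj]
          exact h4 j hjk
        · rw [Function.update_of_ne hj, Function.update_of_ne hk]
          exact h1 j k hjk hj hk
    · by_cases hj : j = i
      · subst hj
        rwa [Function.update_self]
      · rw [Function.update_of_ne hj]; exact h2 j hj

theorem head_R {r n : ℕ} (S : Finset ℕ) (hr : 3 ≤ r) (x : Fin r → Fin n) :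
    ∃ R : Prop, ∀ a, Inc S (Function.update x ⟨0, by omega⟩ a) ↔
      R ∧ (a : ℕ) ∈ S ∧ True ∧ a < x ⟨1, by omega⟩ := by
  refine ⟨_, fun a => (Inc_update S x _ a).trans (and_congr_right fun hR => and_congr_right fun _ => ?_)⟩
  constructor
  · rintro ⟨-, h⟩
    exact ⟨trivial, h _ (by rw [Fin.lt_def]; simp)⟩
  · rintro ⟨-, h⟩
    refine ⟨fun j hj => absurd hj (by rw [Fin.lt_def]; simp), fun j hj => ?_⟩
    by_cases hj1 : j = ⟨1, by omega⟩
    · rw [hj1]; exact h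
    · rw [Fin.lt_def] at hj
      rw [Fin.ext_iff] at hj1
      simp only at hj hj1
      refine h.trans (hR.1 _ _ ?_ ?_ ?_)
      · rw [Fin.lt_def]; simp only; omega
      · rw [Ne, Fin.ext_iff]; simp
      · rw [Ne, Fin.ext_iff]; simp only; omega

theorem tail_R {r n : ℕ} (S : Finset ℕ) (hr : 3 ≤ r) (x : Fin r → Fin n) :
    ∃ R : Prop, ∀ a, Inc S (Function.update x ⟨r - 2, by omega⟩ a) ↔
      R ∧ (a : ℕ) ∈ S ∧ x ⟨r - 3, by omega⟩ < a ∧ a < x ⟨r - 1, by omega⟩ := by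
  refine ⟨_, fun a => (Inc_update S x _ a).trans (and_congr_right fun hR => and_congr_right fun _ => ?_)⟩
  constructor
  · rintro ⟨h', h⟩
    exact ⟨h' _ (by rw [Fin.lt_def]; simp only; omega), h _ (by rw [Fin.lt_def]; simp only; omega)⟩
  · rintro ⟨h', h⟩
    refine ⟨fun j hj => ?_, fun j hj => ?_⟩
    · by_cases hj1 : j = ⟨r - 3, by omega⟩
      · rw [hj1]; exact h'
      · rw [Fin.lt_def] at hj
        rw [Fin.ext_iff] at hj1
        simp only at hj hj1
        refine lt_trans (hR.1 _ _ ?_ ?_ ?_) h'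
        · rw [Fin.lt_def]; simp only; omega
        · rw [Ne, Fin.ext_iff]; simp only; omega
        · rw [Ne, Fin.ext_iff]; simp only; omega
    · have : j = ⟨r - 1, by omega⟩ := by
        rw [Fin.lt_def] at hj
        rw [Fin.ext_iff]
        simp only at hj ⊢
        omega
      rw [this]; exact h

open Classical in
theorem count_bound {r n : ℕ} (hr : 3 ≤ r) (hn : 0 < n) {g : Fin n → Fin n → ℝ}
    (hg : ∀ a b, g a b = 1 ∨ g a b = -1) {γ : ℝ}
    (hd : ∀ w : Fin n → ℝ, (∀ a, |w a| ≤ 1) →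
      ∑ b, |∑ a, if a < b then w a * g a b else 0| ≤ γ * (n:ℝ) ^ 2)
    (S : Finset ℕ) :
    1 / 4 * (((univ : Finset (Fin r → Fin n)).filter (fun x => Inc S x)).card : ℝ) - 3 / 4 * (γ * (n:ℝ) ^ r)
    ≤ (((univ : Finset (Fin r → Fin n)).filter (fun x => Inc S x ∧
      g (x ⟨0, by omega⟩) (x ⟨1, by omega⟩) = 1 ∧ g (x ⟨r - 2, by omega⟩) (x ⟨r - 1, by omega⟩) = -1)).card : ℝ) := by
  have hgabs : ∀ a b, |g a b| ≤ 1 := by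
    intro a b; rcases hg a b with h | h <;> rw [h] <;> norm_num
  have b1 := gen_bound hn hd S ⟨0, by omega⟩ ⟨1, by omega⟩ ⟨2, by omega⟩ (by simp [Fin.ext_iff])
    (by simp [Fin.ext_iff]) (fun _ _ => True) (head_R S hr) (fun _ => 1) (by simp) (by simp)
  have b2 := gen_bound hn hd S ⟨0, by omega⟩ ⟨1, by omega⟩ ⟨2, by omega⟩ (by simp [Fin.ext_iff])
    (by simp [Fin.ext_iff]) (fun _ _ => True) (head_R S hr)
    (fun x => g (x ⟨r - 2, by omega⟩) (x ⟨r - 1, by omega⟩)) (fun x => hgabs _ _)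
    (fun x a => by
      rw [Function.update_of_ne, Function.update_of_ne]
      · rw [Ne, Fin.ext_iff]; simp only; omega
      · rw [Ne, Fin.ext_iff]; simp only; omega)
  have b3 := gen_bound hn hd S ⟨r - 2, by omega⟩ ⟨r - 1, by omega⟩ ⟨r - 3, by omega⟩
    (by rw [Ne, Fin.ext_iff]; simp only; omega)
    (by rw [Ne, Fin.ext_iff]; simp only; omega) (fun y a => y < a) (tail_R S hr) (fun _ => 1) (by simp) (by simp)
  have b1' := (abs_le.1 b1).1
  have b2' := (abs_le.1 b2).2
  have b3' := (abs_le.1 b3).2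
  rw [card_filter, card_filter]
  push_cast
  have hsum : ∑ x : Fin r → Fin n, (if Inc S x ∧
      g (x ⟨0, by omega⟩) (x ⟨1, by omega⟩) = 1 ∧ g (x ⟨r - 2, by omega⟩) (x ⟨r - 1, by omega⟩) = -1 then (1:ℝ) else 0)
      = 1 / 4 * ((∑ x : Fin r → Fin n, if Inc S x then (1:ℝ) else 0)
        + (∑ x : Fin r → Fin n, if Inc S x then g (x ⟨0, by omega⟩) (x ⟨1, by omega⟩) * 1 else 0)
        - (∑ x : Fin r → Fin n, if Inc S x then g (x ⟨r - 2, by omega⟩) (x ⟨r - 1, by omega⟩) * 1 else 0)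
        - (∑ x : Fin r → Fin n, if Inc S x then g (x ⟨0, by omega⟩) (x ⟨1, by omega⟩)
            * g (x ⟨r - 2, by omega⟩) (x ⟨r - 1, by omega⟩) else 0)) := by
    rw [← sum_add_distrib, ← sum_sub_distrib, ← sum_sub_distrib, mul_sum]
    refine sum_congr rfl fun x _ => ?_
    by_cases hI : Inc S x
    · simp only [hI, true_and, if_true]
      rcases hg (x ⟨0, by omega⟩) (x ⟨1, by omega⟩) with h | h <;>
      rcases hg (x ⟨r - 2, by omega⟩) (x ⟨r - 1, by omega⟩) with h' | h' <;>
      rw [h, h'] <;> norm_num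
    · simp [hI]
  rw [hsum]
  linarith

theorem choose_le_inc {r n : ℕ} (S : Finset ℕ) (hS : S ⊆ range n) [DecidablePred (fun x : Fin r → Fin n => Inc S x)] :
    S.card.choose r ≤ ((univ : Finset (Fin r → Fin n)).filter (fun x => Inc S x)).card := by
  classical
  rw [← card_powersetCard]
  refine le_trans (card_le_card ?_) (card_image_le (f := fun x : Fin r → Fin n => univ.image (fun i => (x i : ℕ))))
  intro e he
  rw [mem_powersetCard] at he
  rw [mem_image]
  refine ⟨fun i => ⟨e.orderEmbOfFin he.2 i, mem_range.1 (hS (he.1 (orderEmbOfFin_mem e he.2 i)))⟩, ?_, ?_⟩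
  · rw [mem_filter]
    refine ⟨mem_univ _, fun i j hij => ?_, fun i => he.1 (orderEmbOfFin_mem e he.2 i)⟩
    rw [Fin.lt_def]
    exact (e.orderEmbOfFin he.2).strictMono hij
  · simp only
    ext v
    rw [← Finset.mem_coe, ← Finset.mem_coe, coe_image, coe_univ, Set.image_univ]
    have := range_orderEmbOfFin e he.2
    rw [← this]

end LowerTuples
end UTD

namespace UTD
open Finset
section LowerGraph

open Classical in
/-- the graph built from the sign matrix `g`. -/
noncomputable def signGraph {r n : ℕ} (hr : 3 ≤ r) (g : Fin n → Fin n → ℝ) : RGraph r where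
  verts := range n
  edges := ((univ : Finset (Fin r → Fin n)).filter (fun x => StrictMono x ∧
      g (x ⟨0, by omega⟩) (x ⟨1, by omega⟩) = 1 ∧
      g (x ⟨r - 2, by omega⟩) (x ⟨r - 1, by omega⟩) = -1)).image
        (fun x => univ.image (fun i => (x i : ℕ)))
  edges_subset := by
    intro e he
    obtain ⟨x, -, rfl⟩ := mem_image.1 he
    intro v hv
    obtain ⟨i, -, rfl⟩ := mem_image.1 hv
    exact mem_range.2 (x i).2
  edges_card := by
    intro e he
    obtain ⟨x, hx, rfl⟩ := mem_image.1 he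
    rw [mem_filter] at hx
    rw [card_image_of_injective, card_univ, Fintype.card_fin]
    exact fun i j hij => hx.2.1.injective (Fin.ext hij)

theorem head_eq {r : ℕ} (hr : 3 ≤ r) {x : Fin r → ℕ} (hx : StrictMono x) {P : Finset ℕ}
    (h1 : P ⊆ univ.image x) (h2 : P.card = 2)
    (h3 : ∀ u ∈ P, ∀ w ∈ univ.image x, w ∉ P → u < w) : P = {x ⟨0, by omega⟩, x ⟨1, by omega⟩} := by
  have hmem : ∀ i, x i ∈ univ.image x := fun i => mem_image_of_mem _ (mem_univ _)
  have m0 : x ⟨0, by omega⟩ ∈ P := by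
    by_contra hcon
    obtain ⟨u, hu⟩ : P.Nonempty := card_pos.1 (by omega)
    obtain ⟨i, -, rfl⟩ := mem_image.1 (h1 hu)
    have h4 := h3 _ hu _ (hmem _) hcon
    rw [hx.lt_iff_lt, Fin.lt_def] at h4
    simp at h4
  have m1 : x ⟨1, by omega⟩ ∈ P := by
    by_contra hcon
    have : P ⊆ {x ⟨0, by omega⟩} := by
      intro u hu
      obtain ⟨i, -, rfl⟩ := mem_image.1 (h1 hu)
      have h4 := h3 _ hu _ (hmem _) hcon
      rw [hx.lt_iff_lt, Fin.lt_def] at h4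
      simp only at h4
      rw [mem_singleton]
      congr 1
      apply Fin.ext
      simp only
      omega
    have := card_le_card this
    rw [card_singleton] at this
    omega
  symm
  refine eq_of_subset_of_card_le ?_ ?_
  · intro v hv
    rw [mem_insert, mem_singleton] at hv
    rcases hv with rfl | rfl <;> assumption
  · rw [h2, card_pair]
    rw [Ne, hx.injective.eq_iff, Fin.ext_iff]
    simp

theorem tail_eq {r : ℕ} (hr : 3 ≤ r) {x : Fin r → ℕ} (hx : StrictMono x) {P : Finset ℕ}
    (h1 : P ⊆ univ.image x) (h2 : P.card = 2)
    (h3 : ∀ u ∈ P, ∀ w ∈ univ.image x, w ∉ P → w < u) : P = {x ⟨r - 2, by omega⟩, x ⟨r - 1, by omega⟩} := by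
  have hmem : ∀ i, x i ∈ univ.image x := fun i => mem_image_of_mem _ (mem_univ _)
  have m0 : x ⟨r - 1, by omega⟩ ∈ P := by
    by_contra hcon
    obtain ⟨u, hu⟩ : P.Nonempty := card_pos.1 (by omega)
    obtain ⟨i, -, rfl⟩ := mem_image.1 (h1 hu)
    have h4 := h3 _ hu _ (hmem _) hcon
    rw [hx.lt_iff_lt, Fin.lt_def] at h4
    simp only at h4
    omega
  have m1 : x ⟨r - 2, by omega⟩ ∈ P := by
    by_contra hcon
    have : P ⊆ {x ⟨r - 1, by omega⟩} := by
      intro u hu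
      obtain ⟨i, -, rfl⟩ := mem_image.1 (h1 hu)
      have h4 := h3 _ hu _ (hmem _) hcon
      rw [hx.lt_iff_lt, Fin.lt_def] at h4
      simp only at h4
      rw [mem_singleton]
      congr 1
      apply Fin.ext
      simp only
      omega
    have := card_le_card this
    rw [card_singleton] at this
    omega
  symm
  refine eq_of_subset_of_card_le ?_ ?_
  · intro v hv
    rw [mem_insert, mem_singleton] at hv
    rcases hv with rfl | rfl <;> assumption
  · rw [h2, card_pair]
    rw [Ne, hx.injective.eq_iff, Fin.ext_iff]
    simp only
    omega

theorem signGraph_free {r n : ℕ} (hr : 3 ≤ r) (g : Fin n → Fin n → ℝ) {F : RGraph r}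
    (hhtm : HeadTailMixing F) : ¬ IsSubgraph F (signGraph hr g) := by
  classical
  rintro ⟨φ, hinj, -, hedge⟩
  obtain ⟨e, he, f, hf, p, ⟨hp1, hp2, hp3⟩, hq1, -, hq3⟩ := hhtm φ hinj
  obtain ⟨x, hx, hxe⟩ := mem_image.1 (hedge e he)
  obtain ⟨y, hy, hyf⟩ := mem_image.1 (hedge f hf)
  rw [mem_filter] at hx hy
  have hcard : (p.image φ).card = 2 := by
    rw [card_image_of_injOn, hp2]
    exact hinj.mono (fun v hv => F.edges_subset e he (hp1 hv))
  have hX : StrictMono (fun i => (x i : ℕ)) := fun i j hij => hx.2.1 hij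
  have hY : StrictMono (fun i => (y i : ℕ)) := fun i j hij => hy.2.1 hij
  have e1 := head_eq hr hX (P := p.image φ) (by rw [hxe]; exact image_subset_image hp1) hcard (by
    intro u hu w hw hwP
    rw [hxe] at hw
    obtain ⟨u, hu', rfl⟩ := mem_image.1 hu
    obtain ⟨w, hw', rfl⟩ := mem_image.1 hw
    exact hp3 u hu' w hw' (fun h => hwP (mem_image_of_mem _ h)))
  have e2 := tail_eq hr hY (P := p.image φ) (by rw [hyf]; exact image_subset_image hq1) hcard (by
    intro u hu w hw hwP
    rw [hyf] at hw
    obtain ⟨u, hu', rfl⟩ := mem_image.1 hu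
    obtain ⟨w, hw', rfl⟩ := mem_image.1 hw
    exact hq3 u hu' w hw' (fun h => hwP (mem_image_of_mem _ h)))
  rw [e1] at e2
  have l1 := hX (show (⟨0, by omega⟩ : Fin r) < ⟨1, by omega⟩ by rw [Fin.lt_def]; simp)
  have l2 := hY (show (⟨r - 2, by omega⟩ : Fin r) < ⟨r - 1, by omega⟩ by rw [Fin.lt_def]; simp only; omega)
  simp only at l1 l2 e2
  have q1 : (x ⟨0, by omega⟩ : ℕ) ∈ ({(y ⟨r - 2, by omega⟩ : ℕ), (y ⟨r - 1, by omega⟩ : ℕ)} : Finset ℕ) := by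
    rw [← e2]; simp
  have q2 : (x ⟨1, by omega⟩ : ℕ) ∈ ({(y ⟨r - 2, by omega⟩ : ℕ), (y ⟨r - 1, by omega⟩ : ℕ)} : Finset ℕ) := by
    rw [← e2]; simp
  rw [mem_insert, mem_singleton] at q1 q2
  have r1 : x ⟨0, by omega⟩ = y ⟨r - 2, by omega⟩ := Fin.ext (by omega)
  have r2 : x ⟨1, by omega⟩ = y ⟨r - 1, by omega⟩ := Fin.ext (by omega)
  have c1 := hx.2.2.1
  have c2 := hy.2.2.2
  rw [r1, r2, c2] at c1
  norm_num at c1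

theorem signGraph_dense {r n : ℕ} (hr : 3 ≤ r) (hn : 0 < n) {g : Fin n → Fin n → ℝ}
    (hg : ∀ a b, g a b = 1 ∨ g a b = -1) {ε γ : ℝ} (hε : 0 < ε)
    (hd : ∀ w : Fin n → ℝ, (∀ a, |w a| ≤ 1) →
      ∑ b, |∑ a, if a < b then w a * g a b else 0| ≤ γ * (n:ℝ) ^ 2)
    (hγ : γ = ε * ((ε / 2) ^ r / r.factorial)) (hbig : 2 * r ≤ ε * n) :
    IsDense (signGraph hr g) (1 / 4) ε := by
  classical
  intro S hS hSc
  have hv : (signGraph hr g).verts = range n := rfl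
  rw [hv, card_range] at hSc
  rw [hv] at hS
  have h1 := count_bound hr hn hg hd S
  have h2 : (S.card.choose r : ℝ) ≤ (((univ : Finset (Fin r → Fin n)).filter (fun x => Inc S x)).card : ℝ) := by
    exact_mod_cast choose_le_inc S hS
  have h3 : γ * (n:ℝ) ^ r ≤ ε * S.card.choose r := by
    have h4 := Nat.pow_le_choose (α := ℝ) r S.card
    have hf : (0:ℝ) < r.factorial := by exact_mod_cast r.factorial_pos
    have hrS : (2:ℝ) * r ≤ S.card := hbig.trans hSc
    have hrS' : r ≤ S.card + 1 := by
      have : (2 * r : ℕ) ≤ S.card := by exact_mod_cast hrS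
      omega
    have h5 : ε / 2 * n ≤ ((S.card + 1 - r : ℕ) : ℝ) := by
      rw [Nat.cast_sub hrS']
      push_cast
      linarith
    have h6 : (ε / 2 * n) ^ r ≤ ((S.card + 1 - r : ℕ) : ℝ) ^ r := pow_le_pow_left₀ (by positivity) h5 r
    have h7 : γ * (n:ℝ) ^ r = ε * ((ε / 2 * n) ^ r / r.factorial) := by rw [hγ, mul_pow]; ring
    rw [h7]
    refine mul_le_mul_of_nonneg_left ?_ hε.le
    refine le_trans ?_ h4
    exact div_le_div_of_nonneg_right h6 hf.le
  have h8 : (((univ : Finset (Fin r → Fin n)).filter (fun x => Inc S x ∧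
      g (x ⟨0, by omega⟩) (x ⟨1, by omega⟩) = 1 ∧ g (x ⟨r - 2, by omega⟩) (x ⟨r - 1, by omega⟩) = -1)).card : ℝ)
      ≤ (((signGraph hr g).edges.filter (fun e => e ⊆ S)).card : ℝ) := by
    refine Nat.cast_le.2 ?_
    refine card_le_card_of_injOn (fun x => univ.image (fun i => (x i : ℕ))) ?_ ?_
    · intro x hx
      simp only [coe_filter, mem_univ, true_and, Set.mem_setOf_eq] at hx ⊢
      refine ⟨mem_image.2 ⟨x, ?_, rfl⟩, ?_⟩
      · rw [mem_filter]; exact ⟨mem_univ _, hx.1.1, hx.2⟩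
      · intro v hv
        obtain ⟨i, -, rfl⟩ := mem_image.1 hv
        exact hx.1.2 i
    · intro x hx y hy hxy
      simp only [coe_filter, mem_univ, true_and, Set.mem_setOf_eq] at hx hy
      have hX : StrictMono (fun i => (x i : ℕ)) := fun i j hij => hx.1.1 hij
      have hY : StrictMono (fun i => (y i : ℕ)) := fun i j hij => hy.1.1 hij
      have h9 : Set.range (fun i => (x i : ℕ)) = Set.range (fun i => (y i : ℕ)) := by
        have := congrArg (fun s : Finset ℕ => (s : Set ℕ)) hxy
        simpa only [coe_image, coe_univ, Set.image_univ] using this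
      have h10 := (hX.range_inj hY).1 h9
      funext i
      exact Fin.ext (congrFun h10 i)
  have h11 : (0:ℝ) ≤ S.card.choose r := Nat.cast_nonneg _
  nlinarith

theorem lower_one {r : ℕ} (hr : 3 ≤ r) {F : RGraph r} (hhtm : HeadTailMixing F) {ε : ℝ} (hε : 0 < ε) (N : ℕ) :
    ∃ H : RGraph r, N ≤ H.verts.card ∧ IsDense H (1 / 4) ε ∧ ¬ IsSubgraph F H := by
  obtain ⟨γ, hγ⟩ : ∃ γ : ℝ, γ = ε * ((ε / 2) ^ r / r.factorial) := ⟨_, rfl⟩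
  have hf : (0:ℝ) < r.factorial := by exact_mod_cast r.factorial_pos
  have hγ0 : 0 < γ := by rw [hγ]; positivity
  obtain ⟨n, hn⟩ := exists_nat_ge (max (max (2 / γ ^ 2) (4 / γ ^ 4)) (max (2 * r / ε) (N + 1)))
  have h1 : 2 / γ ^ 2 ≤ n := le_trans (le_trans (le_max_left _ _) (le_max_left _ _)) hn
  have h2 : 4 / γ ^ 4 ≤ n := le_trans (le_trans (le_max_right _ _) (le_max_left _ _)) hn
  have h3 : 2 * r / ε ≤ n := le_trans (le_trans (le_max_left _ _) (le_max_right _ _)) hn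
  have h4 : (N + 1 : ℝ) ≤ n := le_trans (le_trans (le_max_right _ _) (le_max_right _ _)) hn
  have h4' : N + 1 ≤ n := by exact_mod_cast h4
  rw [div_le_iff₀ (by positivity)] at h1 h2 h3
  obtain ⟨g, hg, hs⟩ := sign_exists n
  refine ⟨signGraph hr g, ?_, ?_, signGraph_free hr g hhtm⟩
  · show N ≤ (range n).card
    rw [card_range]; omega
  · exact signGraph_dense hr (by omega) hg hε
      (disc hg hs hγ0 (by linarith) (by linarith)) hγ (by linarith)

theorem lower {r : ℕ} (hr : 3 ≤ r) {F : RGraph r} (hhtm : HeadTailMixing F) :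
    ∃ H : ℕ → RGraph r, LocallyDense H (1 / 4 : ℝ) ∧ ∀ n, ¬ IsSubgraph F (H n) := by
  have h := fun n : ℕ => lower_one hr hhtm (ε := 1 / ((n:ℝ) + 1)) (by positivity) n
  choose H h1 h2 h3 using h
  refine ⟨H, ⟨fun n => 1 / ((n:ℝ) + 1), fun n => by positivity, tendsto_one_div_add_atTop_nhds_zero_nat, ?_, h2⟩, h3⟩
  exact Filter.tendsto_atTop_mono h1 Filter.tendsto_id

end LowerGraph
end UTD

namespace UTD

/-- any quasi-linear, head-tail-mixing r-graph admitting `XX…XZZYY…Y`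
has uniform Turán density 1/4. -/
theorem uniform_turan_density_eq_one_quarter (r : ℕ) (hr : 3 ≤ r) (F : RGraph r)
    (hql : QuasiLinear F) (hhtm : HeadTailMixing F)
    (hadm : AdmitsSeq F (headTailSeq r)) :
    (∃ H : ℕ → RGraph r, LocallyDense H (1 / 4 : ℝ) ∧ ∀ n, ¬ IsSubgraph F (H n)) ∧
    ∀ ε : ℝ, 0 < ε → ∀ H : ℕ → RGraph r, LocallyDense H (1 / 4 + ε) →
      ∃ n, IsSubgraph F (H n) := by
  exact ⟨lower hr hhtm, fun ε hε H hH => upper hr hql hhtm hadm hε H hH⟩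

end UTD
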